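/- arXiv:2406.01459 — 7 statements merged into one kernel-verified Lean document; each statement's English description precedes it below -/
import Mathlib

section
/- Let m and m' be positive integers, let φ : [m] → [m'] be any map, and let T' be the non-decreasing rearrangement of the word (φ(1), φ(2), …, φ(m)) over [m']. If B ⊆ [m]^n is a block set with template 12⋯m (the strictly increasing template over [m] in which each symbol appears exactly once) and degree d, then the image {φ ∘ w : w ∈ B} ⊆ [m']^n is a block set with template T' and degree d. -/
/-!
STATEMENT 2: Identifying symbols maps block sets to block sets.
Words of length `n` over `[m]` are functions `Fin n → Fin m`
(symbol `s` represented by `s - 1 : Fin m`).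
-/

/-- `B` is a block set with template `T : Fin l → Fin m` and degree `d` inside `[m]^n`. -/
def IsBlockSet {m l n : ℕ} (T : Fin l → Fin m) (d : ℕ) (B : Set (Fin n → Fin m)) : Prop :=
  ∃ (I : Fin l → Finset (Fin n)) (a : Fin n → Fin m),
    (∀ j j' : Fin l, j ≠ j' → Disjoint (I j) (I j')) ∧
    (∀ j : Fin l, (I j).card = d) ∧
    B = { w | (∀ i : Fin n, (∀ j : Fin l, i ∉ I j) → w i = a i) ∧
              ∃ σ : Equiv.Perm (Fin l), ∀ j : Fin l, ∀ i ∈ I j, w i = T (σ j) }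

/-- Let `φ : [m] → [m']` be any map and let `T'` be the non-decreasing rearrangement of the
word `(φ 1, …, φ m)` over `[m']` (i.e. `T'` is monotone and is a permutation of `φ` composed
with the identity template). If `B ⊆ [m]^n` is a block set with the strictly increasing
template `1 2 ⋯ m` and degree `d`, then `{φ ∘ w : w ∈ B} ⊆ [m']^n` is a block set with
template `T'` and degree `d`. -/
theorem image_of_blockSet (m m' n d : ℕ) (hm : 0 < m) (hm' : 0 < m')
    (φ : Fin m → Fin m') (T' : Fin m → Fin m') (hmono : Monotone T')
    (hperm : ∃ σ : Equiv.Perm (Fin m), T' = φ ∘ σ)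
    (B : Set (Fin n → Fin m)) (hB : IsBlockSet (fun j : Fin m => j) d B) :
    IsBlockSet T' d ((fun w => φ ∘ w) '' B) := by
  obtain ⟨τ, rfl⟩ := hperm
  obtain ⟨I, a, hdisj, hcard, rfl⟩ := hB
  refine ⟨I, φ ∘ a, hdisj, hcard, Set.ext fun u => ⟨?_, ?_⟩⟩
  · rintro ⟨w, ⟨hconst, σ, hσ⟩, rfl⟩
    exact ⟨fun i hi => congrArg φ (hconst i hi), σ.trans τ.symm, fun j i hi => by simp [hσ j i hi]⟩
  · rintro ⟨hconst, σ, hσ⟩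
    classical
    let w : Fin n → Fin m := fun i => if h : ∃ j, i ∈ I j then τ (σ h.choose) else a i
    have hw : ∀ j, ∀ i ∈ I j, w i = τ (σ j) := by
      intro j i hi
      have h : ∃ j, i ∈ I j := ⟨j, hi⟩
      have hj : h.choose = j := by
        by_contra hne
        exact Finset.disjoint_left.mp (hdisj _ _ hne) h.choose_spec hi
      rw [← hj]
      exact dif_pos h
    have hw' : ∀ i, (∀ j, i ∉ I j) → w i = a i := fun i hi =>
      dif_neg (not_exists.mpr hi)
    refine ⟨w, ⟨hw', σ.trans τ, hw⟩, funext fun i => ?_⟩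
    by_cases h : ∃ j, i ∈ I j
    · obtain ⟨j, hj⟩ := h
      simp [hw j i hj, hσ j i hj]
    · have hi := not_exists.mp h
      simp [hw' i hi, hconst i hi]
end

section
/- For every positive integer d there exist a positive integer m, a positive integer k, and a k-colouring c of all finite words over the alphabet [m] such that for every positive integer n, no block set in [m]^n with template 12⋯m (the strictly increasing template over [m] in which each symbol appears exactly once) and degree at most d is monochromatic under c. -/
/-- A set of words is monochromatic under a colouring `c`. -/
def Monochromatic {α β : Type*} (c : α → β) (B : Set α) : Prop :=
  ∀ w ∈ B, ∀ w' ∈ B, c w = c w'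

section

open Finset

theorem prime_dvd_card_perm_of_local {α : Type*} [Fintype α] [DecidableEq α] {p : ℕ}
    [hp : Fact p.Prime] (J : Finset α) (hJ : J.card + p ≤ Fintype.card α)
    (Q : Equiv.Perm α → Prop) [DecidablePred Q]
    (hQ : ∀ σ τ : Equiv.Perm α, (∀ j ∈ J, σ j = τ j) → Q σ → Q τ) :
    p ∣ #{σ | Q σ} := by
  have hcard : p ∣ Fintype.card (Equiv.Perm {x // x ∉ J}) := by
    rw [Fintype.card_perm, Fintype.card_subtype_compl, Fintype.card_coe]
    exact hp.out.dvd_factorial.2 (by omega)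
  obtain ⟨τ₀, hτ₀⟩ := exists_prime_orderOf_dvd_card p hcard
  set τ : Equiv.Perm α := Equiv.Perm.ofSubtype τ₀
  have hτJ : ∀ j ∈ J, τ j = j := fun j hj =>
    Equiv.Perm.ofSubtype_apply_of_not_mem τ₀ (by simpa using hj)
  have hτ1 : τ ≠ 1 := by
    intro h
    have h1 : τ₀ = 1 := Equiv.Perm.ofSubtype_injective (by simpa using h)
    rw [h1, orderOf_one] at hτ₀
    exact hp.out.one_lt.ne hτ₀
  have hτp : τ ^ p = 1 := by
    rw [← map_pow, ← hτ₀, pow_orderOf_eq_one, map_one]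
  let f : Function.End {σ // Q σ} := fun σ =>
    ⟨σ.1 * τ, hQ σ.1 _ (fun j hj => by simp [hτJ j hj]) σ.2⟩
  have hpow : ∀ k (σ : {σ // Q σ}), ((f ^ k) σ).1 = σ.1 * τ ^ k := by
    intro k
    induction k with
    | zero => intro σ; rw [pow_zero, pow_zero, mul_one]; rfl
    | succ k ih =>
      intro σ
      have hstep : (f ^ (k + 1)) σ = (f ^ k) (f σ) := by rw [pow_succ]; rfl
      rw [hstep, ih, pow_succ', ← mul_assoc]
  have hf : f ^ p ^ 1 = 1 := by
    funext σ
    apply Subtype.ext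
    rw [pow_one, hpow, hτp, mul_one]
    rfl
  have key := Equiv.Perm.card_fixedPoints_modEq hf
  have hempty : Fintype.card (Function.fixedPoints f) = 0 := by
    rw [Fintype.card_eq_zero_iff]
    refine ⟨fun σ => hτ1 ?_⟩
    have h := congrArg Subtype.val σ.2
    exact mul_eq_left.1 h
  rw [hempty] at key
  rw [← Fintype.card_subtype]
  exact (Nat.modEq_zero_iff_dvd).1 key

theorem card_perm_extending {ι α : Type*} [Fintype ι] [Fintype α] [DecidableEq α]
    (j g : ι ↪ α) :
    #{σ : Equiv.Perm α | ∀ t, σ (j t) = g t} =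
      (Fintype.card α - Fintype.card ι).factorial := by
  obtain ⟨σ₀, hσ₀⟩ : ∃ σ₀ : Equiv.Perm α, ∀ t, σ₀ (j t) = g t := by
    let e : {x // x ∈ Set.range j} ≃ {x // x ∈ Set.range g} :=
      (Equiv.ofInjective j j.injective).symm.trans (Equiv.ofInjective g g.injective)
    classical
    refine ⟨e.extendSubtype, fun t => ?_⟩
    rw [Equiv.extendSubtype_apply_of_mem e (j t) ⟨t, rfl⟩]
    simp only [e, Equiv.trans_apply]
    rw [show (⟨j t, ⟨t, rfl⟩⟩ : {x // x ∈ Set.range j}) =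
      Equiv.ofInjective j j.injective t from rfl, Equiv.symm_apply_apply]
    rfl
  classical
  have h1 : Fintype.card {σ : Equiv.Perm α // ∀ t, σ (j t) = g t} =
      Fintype.card {σ : Equiv.Perm α // ∀ a, ¬ (a ∉ Set.range j) → σ a = a} := by
    refine Fintype.card_congr ((Equiv.mulLeft σ₀⁻¹).subtypeEquiv fun σ => ?_)
    simp only [Equiv.coe_mulLeft, not_not, Set.forall_mem_range, Equiv.Perm.mul_apply,
      Equiv.Perm.inv_eq_iff_eq, hσ₀]
  rw [← Fintype.card_subtype, h1,
    Fintype.card_congr (Equiv.Perm.subtypeEquivSubtypePerm (fun a => a ∉ Set.range j)).symm,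
    Fintype.card_perm, Fintype.card_subtype_compl]
  congr 2
  exact (Fintype.card_congr (Equiv.ofInjective j j.injective)).symm

theorem card_transversals {α β : Type*} [Fintype α] [Fintype β] [DecidableEq α]
    [DecidableEq β] (b : α → Option β) {d : ℕ} (hb : ∀ j, #{i | b i = some j} = d) (p : ℕ) :
    #{P : Finset α | P.card = p ∧ ∃ S : Finset β, S.card = p ∧
      P.image b = S.map Function.Embedding.some} = (Fintype.card β).choose p * d ^ p := by
  have h1 : #((powersetCard p (univ : Finset β)).sigma
      fun S => Fintype.piFinset fun j : S => ({i | b i = some j.1} : Finset α)) =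
      (Fintype.card β).choose p * d ^ p := by
    rw [card_sigma]
    have : ∀ S ∈ powersetCard p (univ : Finset β),
        #(Fintype.piFinset fun j : S => ({i | b i = some j.1} : Finset α)) = d ^ p := by
      intro S hS
      rw [mem_powersetCard] at hS
      simp [Fintype.card_piFinset, hb, hS.2]
    rw [sum_congr rfl this]
    simp
  rw [← h1]
  symm
  have him : ∀ (S : Finset β) (f : S → α), (∀ j, b (f j) = some j.1) →
      (univ.image f).image b = S.map Function.Embedding.some := by
    intro S f hf
    ext x
    simp [hf, image_image]
  refine card_bij (fun x _ => univ.image x.2) ?_ ?_ ?_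
  · rintro ⟨S, f⟩ h
    simp only [mem_sigma, mem_powersetCard, Fintype.mem_piFinset, mem_filter, mem_univ,
      true_and, subset_univ] at h
    obtain ⟨hS, hf⟩ := h
    simp only [mem_filter, mem_univ, true_and]
    refine ⟨?_, S, hS, him S f hf⟩
    rw [card_image_of_injective, card_univ, Fintype.card_coe, hS]
    intro x y hxy
    have := congrArg b hxy
    rw [hf, hf] at this
    exact Subtype.ext (Option.some_injective _ this)
  · rintro ⟨S, f⟩ h ⟨S', f'⟩ h' heq
    simp only [mem_sigma, mem_powersetCard, Fintype.mem_piFinset, mem_filter, mem_univ,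
      true_and, subset_univ] at h h' heq
    have hSS : S = S' := by
      apply map_injective Function.Embedding.some
      rw [← him S f h.2, ← him S' f' h'.2, heq]
    subst hSS
    congr 1
    funext j
    have hj : f j ∈ univ.image f' := heq ▸ mem_image_of_mem f (mem_univ j)
    obtain ⟨j', -, hj'⟩ := mem_image.1 hj
    have := congrArg b hj'
    rw [h.2, h'.2] at this
    rw [← hj', Subtype.ext (Option.some_injective _ this)]
  · intro P hP
    simp only [mem_filter, mem_univ, true_and] at hP
    obtain ⟨hPc, S, hS, hPS⟩ := hP
    have hex : ∀ j : S, ∃ i ∈ P, b i = some j.1 := by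
      intro j
      have : some j.1 ∈ P.image b := by rw [hPS]; simp
      simpa using this
    choose f hfP hf using hex
    refine ⟨⟨S, f⟩, by simp [hS, hf], ?_⟩
    refine eq_of_subset_of_card_le (fun x hx => ?_) ?_
    · obtain ⟨j, -, rfl⟩ := mem_image.1 hx
      exact hfP j
    · rw [hPc, ← hS, ← card_map Function.Embedding.some, ← him S f hf]
      exact card_image_le

open Classical in
/-- The number of occurrences of `0 1 ⋯ (p - 1)` as a subword of `w`. -/
noncomputable def increasingSubwordCount {p m n : ℕ} (hpm : p ≤ m) (w : Fin n → Fin m) : ℕ :=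
  #{P : Finset (Fin n) | ∃ h : P.card = p,
    ∀ t, w (P.orderEmbOfFin h t) = Fin.castLE hpm t}

/-- The word obtained from `a` by writing `σ j` on the block labelled `j`. -/
def fillBlocks {m n : ℕ} (b : Fin n → Option (Fin m)) (a : Fin n → Fin m)
    (σ : Equiv.Perm (Fin m)) (i : Fin n) : Fin m :=
  (b i).elim (a i) σ

open Classical in
theorem card_perm_occurrence_eq {p m n : ℕ} [hp : Fact p.Prime] (hm : m = p + (p - 1))
    (hpm : p ≤ m) (b : Fin n → Option (Fin m)) (a : Fin n → Fin m) (P : Finset (Fin n)) :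
    (#{σ : Equiv.Perm (Fin m) | ∃ h : P.card = p,
      ∀ t, fillBlocks b a σ (P.orderEmbOfFin h t) = Fin.castLE hpm t} : ZMod p) =
    if P.card = p ∧ ∃ S : Finset (Fin m), S.card = p ∧
      P.image b = S.map Function.Embedding.some then ((p - 1).factorial : ZMod p) else 0 := by
  by_cases hP : P.card = p
  swap
  · simp [hP]
  split_ifs with hT
  · obtain ⟨-, S, hS, hPS⟩ := hT
    have hinj : Set.InjOn b P := by
      rw [← card_image_iff, hPS, card_map, hS, hP]
    have hex : ∀ t, ∃ j, b (P.orderEmbOfFin hP t) = some j := by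
      intro t
      have : b (P.orderEmbOfFin hP t) ∈ S.map Function.Embedding.some :=
        hPS ▸ mem_image_of_mem b (orderEmbOfFin_mem P hP t)
      obtain ⟨j, -, hj⟩ := mem_map.1 this
      exact ⟨j, hj.symm⟩
    choose j hj using hex
    have hjinj : Function.Injective j := by
      intro s t hst
      apply (P.orderEmbOfFin hP).injective
      apply hinj (orderEmbOfFin_mem P hP s) (orderEmbOfFin_mem P hP t)
      rw [hj, hj, hst]
    have hcount := card_perm_extending (⟨j, hjinj⟩ : Fin p ↪ Fin m) (Fin.castLEEmb hpm)
    simp only [Fintype.card_fin, Function.Embedding.coeFn_mk, Fin.castLEEmb_apply] at hcount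
    rw [show m - p = p - 1 by omega] at hcount
    rw [← hcount]
    congr 2
    ext σ
    simp [hP, fillBlocks, hj]
  · rw [ZMod.natCast_eq_zero_iff]
    have hsub : (eraseNone (P.image b)).map Function.Embedding.some ⊆ P.image b := by
      rw [map_some_eraseNone]
      exact erase_subset _ _
    have hle : (P.image b).card ≤ p := hP ▸ card_image_le
    have hlt : (eraseNone (P.image b)).card < p := by
      by_contra! hge
      have heq := eq_of_subset_of_card_le hsub (by rw [card_map]; omega)
      refine hT ⟨hP, eraseNone (P.image b), ?_, heq.symm⟩
      have := card_le_card hsub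
      rw [card_map] at this
      omega
    apply prime_dvd_card_perm_of_local (eraseNone (P.image b))
    · rw [Fintype.card_fin]
      omega
    · rintro σ τ hστ ⟨h, hσ⟩
      refine ⟨h, fun t => ?_⟩
      rw [← hσ t]
      have hmem := mem_image_of_mem b (orderEmbOfFin_mem P h t)
      unfold fillBlocks
      cases hb : b (P.orderEmbOfFin h t) with
      | none => rfl
      | some j => exact (hστ j (mem_eraseNone.2 (hb ▸ hmem))).symm

theorem sum_increasingSubwordCount_fillBlocks {p m n d : ℕ} [hp : Fact p.Prime]
    (hm : m = p + (p - 1)) (hpm : p ≤ m) (b : Fin n → Option (Fin m)) (a : Fin n → Fin m)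
    (hb : ∀ j, #{i | b i = some j} = d) :
    ∑ σ, (increasingSubwordCount hpm (fillBlocks b a σ) : ZMod p) =
      ((m.choose p * d ^ p * (p - 1).factorial : ℕ) : ZMod p) := by
  classical
  have hswap : ∑ σ, increasingSubwordCount hpm (fillBlocks b a σ) =
      ∑ P : Finset (Fin n), #{σ : Equiv.Perm (Fin m) | ∃ h : P.card = p,
        ∀ t, fillBlocks b a σ (P.orderEmbOfFin h t) = Fin.castLE hpm t} := by
    simp only [increasingSubwordCount, card_filter]
    exact sum_comm
  rw [← Nat.cast_sum, hswap, Nat.cast_sum]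
  simp only [card_perm_occurrence_eq hm]
  rw [← sum_filter, sum_const, card_transversals b hb, Fintype.card_fin, nsmul_eq_mul]
  push_cast
  ring

theorem not_prime_dvd_choose_mul {p m d : ℕ} (hp : p.Prime) (hm : m = p + (p - 1))
    (hd : 0 < d) (hdp : d < p) : ¬ p ∣ m.choose p * d ^ p * (p - 1).factorial := by
  have hpos := hp.pos
  rw [hp.dvd_mul, hp.dvd_mul]
  rintro ((h | h) | h)
  · have := Fact.mk hp
    have h1 := Choose.choose_modEq_choose_mod_mul_choose_div_nat (n := m) (k := p) (p := p)
    have h2 : m % p = p - 1 := by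
      rw [hm, Nat.add_mod_left, Nat.mod_eq_of_lt (by omega)]
    have h3 : m / p = 1 := by
      rw [hm, Nat.add_div_left _ hpos, Nat.div_eq_of_lt (by omega)]
    rw [h2, h3, Nat.mod_self, Nat.div_self hpos] at h1
    simp only [Nat.choose_zero_right, Nat.choose_self, mul_one] at h1
    have h4 := (h1.symm.trans ((Nat.modEq_zero_iff_dvd).2 h))
    exact hp.one_lt.ne' (Nat.dvd_one.1 ((Nat.modEq_zero_iff_dvd).1 h4))
  · exact absurd (Nat.le_of_dvd hd (hp.dvd_of_dvd_pow h)) (by omega)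
  · have := hp.dvd_factorial.1 h
    omega

end

/-- For every positive integer `d` there exist a positive integer `m`, a positive integer `k`
and a `k`-colouring of all finite words over `[m]` such that, for every `n ≥ 1`, no block set
in `[m]^n` with the strictly increasing template `1 2 ⋯ m` (here `fun j : Fin m => j`)
and degree at most `d` is monochromatic. -/
theorem unbounded_block_sizes_increasing_template (d : ℕ) (hd : 0 < d) :
    ∃ m : ℕ, 0 < m ∧ ∃ k : ℕ, 0 < k ∧
      ∃ c : (n : ℕ) → (Fin n → Fin m) → Fin k,
        ∀ n : ℕ, 0 < n → ∀ d' : ℕ, 0 < d' → d' ≤ d →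
          ∀ B : Set (Fin n → Fin m),
            IsBlockSet (fun j : Fin m => j) d' B → ¬ Monochromatic (c n) B := by
  classical
  obtain ⟨p, hdp, hp⟩ := Nat.exists_infinite_primes (d + 1)
  have := Fact.mk hp
  have hpos := hp.pos
  have hpm : p ≤ p + (p - 1) := by omega
  refine ⟨p + (p - 1), by omega, p, hpos,
    fun n w => ⟨increasingSubwordCount hpm w % p, Nat.mod_lt _ hpos⟩, ?_⟩
  rintro n - d' hd' hd'd B ⟨I, a, hdisj, hcard, rfl⟩ hmono
  have hlabel : ∃ b : Fin n → Option (Fin (p + (p - 1))), ∀ i j, b i = some j ↔ i ∈ I j := by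
    refine ⟨fun i => if h : ∃ j, i ∈ I j then some h.choose else none, fun i j => ?_⟩
    by_cases h : ∃ j, i ∈ I j
    · simp only [h, dite_true, Option.some.injEq]
      refine ⟨fun hj => hj ▸ h.choose_spec, fun hj => ?_⟩
      by_contra hne
      exact Finset.disjoint_left.1 (hdisj _ _ hne) h.choose_spec hj
    · simp only [h, dite_false, reduceCtorEq, false_iff]
      exact fun hj => h ⟨j, hj⟩
  obtain ⟨b, hb⟩ := hlabel
  have hmem : ∀ σ, fillBlocks b a σ ∈ { w : Fin n → Fin (p + (p - 1)) |
      (∀ i : Fin n, (∀ j, i ∉ I j) → w i = a i) ∧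
      ∃ σ : Equiv.Perm (Fin (p + (p - 1))), ∀ j, ∀ i ∈ I j, w i = σ j } := by
    refine fun σ => ⟨fun i hi => ?_, σ, fun j i hi => ?_⟩
    · have hnone : b i = none := Option.eq_none_iff_forall_ne_some.2
        fun j hj => hi j ((hb i j).1 hj)
      simp [fillBlocks, hnone]
    · simp [fillBlocks, (hb i j).2 hi]
  have hsum := sum_increasingSubwordCount_fillBlocks rfl hpm b a (d := d') (fun j => by
    rw [← hcard j]
    congr 1
    ext i
    simp [hb])
  have hconst : ∀ σ, (increasingSubwordCount hpm (fillBlocks b a σ) : ZMod p) =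
      increasingSubwordCount hpm (fillBlocks b a 1) := fun σ =>
    (ZMod.natCast_eq_natCast_iff' _ _ _).2
      (congrArg Fin.val (hmono _ (hmem σ) _ (hmem 1)))
  have hfact : ((p + (p - 1)).factorial : ZMod p) = 0 :=
    (ZMod.natCast_eq_zero_iff _ _).2 (hp.dvd_factorial.2 hpm)
  rw [Finset.sum_congr rfl fun σ _ => hconst σ, Finset.sum_const, Finset.card_univ,
    Fintype.card_perm, Fintype.card_fin, nsmul_eq_mul, hfact, zero_mul] at hsum
  exact not_prime_dvd_choose_mul hp rfl hd' (by omega)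
    ((ZMod.natCast_eq_zero_iff _ _).1 hsum.symm)
end

section
/- For every positive integer k there exists a positive integer n such that for every k-colouring χ of [3]^n there exist positions i_1 < i_2 < i_3 < i_4 < i_5 < i_6 in [n] and values a_i ∈ [3] for each i ∈ [n] \ {i_1,…,i_6} with the following property: setting A = {i_1, i_6}, B = {i_2, i_5}, C = {i_3, i_4}, for every permutation σ of {1,2,3} let w^σ ∈ [3]^n be the word with w^σ_i = a_i for i ∉ A ∪ B ∪ C, w^σ_i = σ(1) for i ∈ A, w^σ_i = σ(2) for i ∈ B, and w^σ_i = σ(3) for i ∈ C; then all six words w^σ receive the same colour under χ. (In other words, every k-colouring of [3]^n contains a monochromatic block set with template 123, blocks of size 2, and pattern ABCCBA.) -/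
/-!
STATEMENT 4: For the template `123`, block size 2 with the fixed pattern `ABCCBA` suffices.
Words of length `n` over `[3]` are functions `Fin n → Fin 3`
(symbols `1, 2, 3` represented by `0, 1, 2 : Fin 3`).
-/

/-- Given six positions `p 0 < p 1 < ⋯ < p 5` forming the pattern `ABCCBA`
(`A = {p 0, p 5}`, `B = {p 1, p 4}`, `C = {p 2, p 3}`), reference values `a`, and a
permutation `σ` of the three symbols, `patternWord p a σ` is the word taking the value
`σ 0` on `A`, `σ 1` on `B`, `σ 2` on `C`, and `a i` elsewhere. -/
def patternWord {n : ℕ} (p : Fin 6 → Fin n) (a : Fin n → Fin 3) (σ : Equiv.Perm (Fin 3)) :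
    Fin n → Fin 3 :=
  fun i =>
    if i = p 0 ∨ i = p 5 then σ 0
    else if i = p 1 ∨ i = p 4 then σ 1
    else if i = p 2 ∨ i = p 3 then σ 2
    else a i

/-- Auxiliary step for Ramsey's theorem: if the theorem holds for `r`-sets, then every large set
contains an `m`-set `T` on which the colour of an `(r + 1)`-set depends only on its minimum. -/
theorem exists_colour_determined_by_min {κ : Type*} (r : ℕ)
    (ih : ∀ m : ℕ, ∃ n : ℕ, ∀ S : Finset ℕ, n ≤ S.card → ∀ c : Finset ℕ → κ,
      ∃ T ⊆ S, T.card = m ∧ ∃ col, ∀ s ⊆ T, s.card = r → c s = col) (m : ℕ) :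
    ∃ n : ℕ, ∀ S : Finset ℕ, n ≤ S.card → ∀ c : Finset ℕ → κ,
      ∃ T ⊆ S, T.card = m ∧ ∃ d : ℕ → κ, ∀ x ∈ T, ∀ s ⊆ T, (∀ y ∈ s, x < y) → s.card = r →
        c (insert x s) = d x := by
  induction m with
  | zero =>
    exact ⟨0, fun S _ c => ⟨∅, by simp, rfl, fun _ => c ∅, by simp⟩⟩
  | succ m ihm =>
    obtain ⟨n, hn⟩ := ihm
    obtain ⟨R, hR⟩ := ih n
    refine ⟨R + 1, fun S hS c => ?_⟩
    have hne : S.Nonempty := Finset.card_pos.1 (by omega)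
    set x := S.min' hne with hx
    have hxS : x ∈ S := S.min'_mem hne
    obtain ⟨T', hT', hT'c, col, hcol⟩ := hR (S.erase x)
      (by rw [Finset.card_erase_of_mem hxS]; omega) (fun s => c (insert x s))
    obtain ⟨T, hT, hTc, d, hd⟩ := hn T' hT'c.ge c
    have hlt : ∀ y ∈ T, x < y := fun y hy => by
      have hy' := Finset.mem_erase.1 (hT' (hT hy))
      exact lt_of_le_of_ne (S.min'_le y hy'.2) (Ne.symm hy'.1)
    have hxT : x ∉ T := fun h => lt_irrefl _ (hlt x h)
    have hsub : ∀ y ∈ insert x T, ∀ s ⊆ insert x T, (∀ z ∈ s, y < z) → s ⊆ T := by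
      intro y hy s hs hys z hz
      rcases Finset.mem_insert.1 (hs hz) with rfl | h
      · rcases Finset.mem_insert.1 hy with h' | h'
        · exact absurd (hys _ hz) (by rw [h']; exact lt_irrefl _)
        · exact absurd (hys _ hz) (hlt y h').not_gt
      · exact h
    refine ⟨insert x T, ?_, by rw [Finset.card_insert_of_notMem hxT, hTc],
      fun y => if y = x then col else d y, ?_⟩
    · exact Finset.insert_subset hxS (hT.trans (hT'.trans (Finset.erase_subset _ _)))
    · intro y hy s hs hys hsr
      have hsT := hsub y hy s hs hys
      rcases Finset.mem_insert.1 hy with rfl | h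
      · simpa using hcol s (hsT.trans hT) hsr
      · have : y ≠ x := (hlt y h).ne'
        simpa [this] using hd y h s hsT hys hsr

/-- Finite Ramsey theorem for `r`-subsets of finite sets of natural numbers. -/
theorem finite_ramsey {κ : Type*} [Finite κ] (r m : ℕ) :
    ∃ n : ℕ, ∀ S : Finset ℕ, n ≤ S.card → ∀ c : Finset ℕ → κ,
      ∃ T ⊆ S, T.card = m ∧ ∃ col, ∀ s ⊆ T, s.card = r → c s = col := by
  classical
  have := Fintype.ofFinite κ
  induction r generalizing m with
  | zero =>
    refine ⟨m, fun S hS c => ?_⟩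
    obtain ⟨T, hT, hTc⟩ := Finset.exists_subset_card_eq hS
    exact ⟨T, hT, hTc, c ∅, fun s _ h => by rw [Finset.card_eq_zero.1 h]⟩
  | succ r ih =>
    obtain ⟨n, hn⟩ := exists_colour_determined_by_min r ih (Fintype.card κ * m + 1)
    refine ⟨n, fun S hS c => ?_⟩
    obtain ⟨T, hT, hTc, d, hd⟩ := hn S hS c
    obtain ⟨col, -, hcol⟩ := Finset.exists_lt_card_fiber_of_mul_lt_card_of_maps_to
      (s := T) (t := Finset.univ) (f := d) (n := m) (fun _ _ => Finset.mem_univ _)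
      (by rw [hTc, Finset.card_univ]; omega)
    obtain ⟨T₀, hT₀, hT₀c⟩ := Finset.exists_subset_card_eq hcol.le
    have hT₀T : T₀ ⊆ T := hT₀.trans (Finset.filter_subset _ _)
    refine ⟨T₀, hT₀T.trans hT, hT₀c, col, fun s hs hsr => ?_⟩
    have hne : s.Nonempty := Finset.card_pos.1 (by omega)
    have hmem := s.min'_mem hne
    rw [← Finset.insert_erase hmem, hd _ (hT₀T (hs hmem)) _
      ((Finset.erase_subset _ _).trans (hs.trans hT₀T))
      (fun y hy => s.min'_lt_of_mem_erase_min' hne hy)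
      (by rw [Finset.card_erase_of_mem hmem]; omega)]
    exact (Finset.mem_filter.1 (hT₀ (hs hmem))).2

/-- Finite Ramsey theorem for colourings of increasing sequences of length `r`. -/
theorem finite_ramsey_strictMono {κ : Type*} [Finite κ] (r m : ℕ) :
    ∃ n : ℕ, ∀ c : (Fin r → ℕ) → κ, ∃ e : ℕ → ℕ, StrictMono e ∧ (∀ j < m, e j < n) ∧
      ∃ col, ∀ h : Fin r → ℕ, StrictMono h → (∀ j, h j < m) → c (e ∘ h) = col := by
  classical
  obtain ⟨n, hn⟩ := finite_ramsey (κ := κ) r m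
  refine ⟨n, fun c => ?_⟩
  obtain ⟨T, hT, hTc, col, hcol⟩ := hn (Finset.range n) (by simp)
    (fun s => if h : s.card = r then c (s.orderEmbOfFin h) else c 0)
  let e : ℕ → ℕ := fun j => if h : j < m then T.orderEmbOfFin hTc ⟨j, h⟩ else n + j
  have hem : ∀ j (h : j < m), e j = T.orderEmbOfFin hTc ⟨j, h⟩ := fun j h => dif_pos h
  have heT : ∀ j < m, e j ∈ T := fun j h => by
    rw [hem j h]; exact Finset.orderEmbOfFin_mem _ _ _
  have hen : ∀ j < m, e j < n := fun j h => Finset.mem_range.1 (hT (heT j h))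
  have hmono : StrictMono e := by
    intro a b hab
    by_cases hb : b < m
    · rw [hem a (hab.trans hb), hem b hb]
      exact (T.orderEmbOfFin hTc).strictMono hab
    · have hb' : e b = n + b := dif_neg hb
      by_cases ha : a < m
      · have := hen a ha
        omega
      · have ha' : e a = n + a := dif_neg ha
        omega
  refine ⟨e, hmono, hen, col, fun h hh hhm => ?_⟩
  have hcomp : StrictMono (e ∘ h) := hmono.comp hh
  have hcard : (Finset.univ.image (e ∘ h)).card = r := by
    rw [Finset.card_image_of_injective _ hcomp.injective, Finset.card_fin]
  have key := hcol (Finset.univ.image (e ∘ h))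
    (fun y hy => by
      obtain ⟨j, -, rfl⟩ := Finset.mem_image.1 hy
      exact heT _ (hhm j)) hcard
  rw [dif_pos hcard] at key
  rwa [Finset.orderEmbOfFin_unique hcard (f := e ∘ h)
    (fun j => Finset.mem_image_of_mem _ (Finset.mem_univ _)) hcomp]

/-- The increasing map `ℕ → ℕ` whose range omits exactly `a` and `b`, when `a < b`. -/
def skipTwo (a b j : ℕ) : ℕ := if j < a then j else if j + 1 < b then j + 1 else j + 2

theorem skipTwo_strictMono (a b : ℕ) : StrictMono (skipTwo a b) := by
  intro x y hxy
  unfold skipTwo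
  split_ifs <;> omega

theorem skipTwo_lt (a b : ℕ) {j L : ℕ} (hj : j < L) : skipTwo a b j < L + 2 := by
  unfold skipTwo
  split_ifs <;> omega

theorem exists_skipTwo_eq {a b L y : ℕ} (hb : b < L + 2) (hab : a < b) (hy : y < L + 2)
    (hya : y ≠ a) (hyb : y ≠ b) : ∃ j < L, skipTwo a b j = y := by
  unfold skipTwo
  by_cases h₁ : y < a
  · exact ⟨y, by omega, by rw [if_pos h₁]⟩
  by_cases h₂ : y < b
  · exact ⟨y - 1, by omega, by split_ifs <;> omega⟩
  · exact ⟨y - 2, by omega, by split_ifs <;> omega⟩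

open Classical in
/-- The word with letter `2` on the set `P` and letter `1` elsewhere. -/
noncomputable def indicatorWord (L : ℕ) (P : ℕ → Prop) (x : Fin L) : Fin 3 :=
  if P x then 2 else 1

set_option maxHeartbeats 2000000 in
/-- Let `V` carry `σ 0`, `σ 1`, `σ 2` on three pairs of positions arranged as `ABCCBA`. Deleting the
two letters `0` leaves the indicator word of `Y ∪ X ∪ Z` together with two further positions,
one of each parity. -/
theorem exists_skipTwo_comp_eq {L t₁ t₂ t₃ t₄ t₅ t₆ : ℕ} {Y X Z : ℕ → Prop}
    (h₁₂ : t₁ < t₂) (h₂₃ : t₂ < t₃) (h₃₄ : t₃ < t₄) (h₄₅ : t₄ < t₅) (h₅₆ : t₅ < t₆)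
    (hY : ∀ x, Y x → x < 2 * t₁) (hX : ∀ x, X x → 2 * t₃ + 1 < x ∧ x < 2 * t₄)
    (hZ : ∀ x, Z x → 2 * t₆ + 1 < x) (ht : 2 * t₆ + 1 < L)
    (σ : Equiv.Perm (Fin 3)) (V : ℕ → Fin 3)
    (hV₁ : V (2 * t₁) = σ 0) (hV₂ : V (2 * t₂ + 1) = σ 1) (hV₃ : V (2 * t₃ + 1) = σ 2)
    (hV₄ : V (2 * t₄ + 2) = σ 2) (hV₅ : V (2 * t₅ + 2) = σ 1) (hV₆ : V (2 * t₆ + 3) = σ 0)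
    (hV : ∀ y < L + 2, y ≠ 2 * t₁ → y ≠ 2 * t₂ + 1 → y ≠ 2 * t₃ + 1 → y ≠ 2 * t₄ + 2 →
      y ≠ 2 * t₅ + 2 → y ≠ 2 * t₆ + 3 →
      (Y y ∨ X (y - 1) ∨ Z (y - 2) → V y = 2) ∧ (¬ (Y y ∨ X (y - 1) ∨ Z (y - 2)) → V y = 1)) :
    ∃ a c, a < c ∧ c < L + 2 ∧ V a = 0 ∧ V c = 0 ∧ ∃ u ∈ [t₁, t₂, t₃], ∃ v ∈ [t₄, t₅, t₆],
      ((fun j : Fin L => V (skipTwo a c j)) =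
          indicatorWord L (fun x => Y x ∨ X x ∨ Z x ∨ x = 2 * u ∨ x = 2 * v + 1)) ∨
      ((fun j : Fin L => V (skipTwo a c j)) =
          indicatorWord L (fun x => Y x ∨ X x ∨ Z x ∨ x = 2 * u + 1 ∨ x = 2 * v)) := by
  have hσ : ∀ σ : Equiv.Perm (Fin 3),
      (σ 0 = 0 ∧ σ 1 = 1 ∧ σ 2 = 2) ∨ (σ 0 = 0 ∧ σ 1 = 2 ∧ σ 2 = 1) ∨
      (σ 0 = 1 ∧ σ 1 = 0 ∧ σ 2 = 2) ∨ (σ 0 = 2 ∧ σ 1 = 0 ∧ σ 2 = 1) ∨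
      (σ 0 = 1 ∧ σ 1 = 2 ∧ σ 2 = 0) ∨ (σ 0 = 2 ∧ σ 1 = 1 ∧ σ 2 = 0) := by decide
  have key : ∀ (a c : ℕ) (P : ℕ → Prop),
      (∀ j < L, (P j → V (skipTwo a c j) = 2) ∧ (¬ P j → V (skipTwo a c j) = 1)) →
      (fun j : Fin L => V (skipTwo a c j)) = indicatorWord L P := by
    intro a c P h
    funext j
    by_cases hj : P j
    · rw [(h j j.2).1 hj, indicatorWord, if_pos hj]
    · rw [(h j j.2).2 hj, indicatorWord, if_neg hj]
  rcases hσ σ with ⟨h0, h1, h2⟩ | ⟨h0, h1, h2⟩ | ⟨h0, h1, h2⟩ | ⟨h0, h1, h2⟩ | ⟨h0, h1, h2⟩ |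
    ⟨h0, h1, h2⟩ <;> rw [h0] at hV₁ hV₆ <;> rw [h1] at hV₂ hV₅ <;> rw [h2] at hV₃ hV₄
  · refine ⟨2 * t₁, 2 * t₆ + 3, by omega, by omega, hV₁, hV₆, t₃, by simp, t₄, by simp,
      Or.inl (key _ _ _ fun j hj => ?_)⟩
    have := hV _ (skipTwo_lt (2 * t₁) (2 * t₆ + 3) hj)
    unfold skipTwo at *
    grind
  · refine ⟨2 * t₁, 2 * t₆ + 3, by omega, by omega, hV₁, hV₆, t₂, by simp, t₅, by simp,
      Or.inl (key _ _ _ fun j hj => ?_)⟩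
    have := hV _ (skipTwo_lt (2 * t₁) (2 * t₆ + 3) hj)
    unfold skipTwo at *
    grind
  · refine ⟨2 * t₂ + 1, 2 * t₅ + 2, by omega, by omega, hV₂, hV₅, t₃, by simp, t₄, by simp,
      Or.inl (key _ _ _ fun j hj => ?_)⟩
    have := hV _ (skipTwo_lt (2 * t₂ + 1) (2 * t₅ + 2) hj)
    unfold skipTwo at *
    grind
  · refine ⟨2 * t₂ + 1, 2 * t₅ + 2, by omega, by omega, hV₂, hV₅, t₁, by simp, t₆, by simp,
      Or.inl (key _ _ _ fun j hj => ?_)⟩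
    have := hV _ (skipTwo_lt (2 * t₂ + 1) (2 * t₅ + 2) hj)
    unfold skipTwo at *
    grind
  · refine ⟨2 * t₃ + 1, 2 * t₄ + 2, by omega, by omega, hV₃, hV₄, t₂, by simp, t₅, by simp,
      Or.inr (key _ _ _ fun j hj => ?_)⟩
    have := hV _ (skipTwo_lt (2 * t₃ + 1) (2 * t₄ + 2) hj)
    unfold skipTwo at *
    grind
  · refine ⟨2 * t₃ + 1, 2 * t₄ + 2, by omega, by omega, hV₃, hV₄, t₁, by simp, t₆, by simp,
      Or.inl (key _ _ _ fun j hj => ?_)⟩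
    have := hV _ (skipTwo_lt (2 * t₃ + 1) (2 * t₄ + 2) hj)
    unfold skipTwo at *
    grind

/-- For every finite set of colours there is a length `L` such that every colouring of the words over
`{1, 2}` of length `L` admits a background `Y ∪ X ∪ Z` and three choices each for the left and the
right extra position, such that all the resulting words, for both choices of parities, have the
same colour. -/
theorem exists_monochromatic_indicatorWords (κ : Type*) [Finite κ] :
    ∃ L : ℕ, ∀ G : (Fin L → Fin 3) → κ, ∃ (t₁ t₂ t₃ t₄ t₅ t₆ : ℕ) (Y X Z : ℕ → Prop),
      t₁ < t₂ ∧ t₂ < t₃ ∧ t₃ < t₄ ∧ t₄ < t₅ ∧ t₅ < t₆ ∧ 2 * t₆ + 1 < L ∧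
      (∀ x, Y x → x < 2 * t₁) ∧ (∀ x, X x → 2 * t₃ + 1 < x ∧ x < 2 * t₄) ∧
      (∀ x, Z x → 2 * t₆ + 1 < x) ∧ ∃ col, ∀ u ∈ [t₁, t₂, t₃], ∀ v ∈ [t₄, t₅, t₆],
        G (indicatorWord L fun x => Y x ∨ X x ∨ Z x ∨ x = 2 * u ∨ x = 2 * v + 1) = col ∧
        G (indicatorWord L fun x => Y x ∨ X x ∨ Z x ∨ x = 2 * u + 1 ∨ x = 2 * v) = col := by
  have := Fintype.ofFinite κ
  set M := Fintype.card κ + 1 with hM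
  obtain ⟨R, hR⟩ := finite_ramsey_strictMono (κ := Fin M → κ) M (M + 4)
  refine ⟨2 * R, fun G => ?_⟩
  obtain ⟨e, he, heR, H, hH⟩ := hR fun f i =>
    G (indicatorWord (2 * R) fun x => ∃ j, x = 2 * f j + if j = i then 0 else 1)
  obtain ⟨i, i', hne, hii⟩ := Fintype.exists_ne_map_eq_of_card_lt H (by simp [hM])
  wlog hlt : i < i' generalizing i i'
  · exact this i' i hne.symm hii.symm (lt_of_le_of_ne (not_lt.1 hlt) hne.symm)
  have hlt' : (i : ℕ) < i' := hlt
  have hi'M := i'.isLt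
  have key : ∀ a ≤ 2, ∀ b ≤ 2,
      G (indicatorWord (2 * R) fun x => (∃ j < (i : ℕ), x = 2 * e j + 1) ∨
        (∃ j, (i : ℕ) < j ∧ j < i' ∧ x = 2 * e (j + 2) + 1) ∨
        (∃ j, (i' : ℕ) < j ∧ j < M ∧ x = 2 * e (j + 4) + 1) ∨
        x = 2 * e (i + a) ∨ x = 2 * e (i' + 2 + b) + 1) = H i ∧
      G (indicatorWord (2 * R) fun x => (∃ j < (i : ℕ), x = 2 * e j + 1) ∨
        (∃ j, (i : ℕ) < j ∧ j < i' ∧ x = 2 * e (j + 2) + 1) ∨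
        (∃ j, (i' : ℕ) < j ∧ j < M ∧ x = 2 * e (j + 4) + 1) ∨
        x = 2 * e (i + a) + 1 ∨ x = 2 * e (i' + 2 + b)) = H i := by
    intro a ha b hb
    let h : ℕ → ℕ := fun j => if j < i then j else if j = i then i + a else
      if j < i' then j + 2 else if j = i' then i' + 2 + b else j + 4
    have hh : StrictMono h := by
      intro x y hxy
      simp only [h]
      split_ifs <;> omega
    have h₁ : ∀ j < (i : ℕ), h j = j := fun j hj => if_pos hj
    have h₂ : h i = i + a := by simp [h]
    have h₃ : ∀ j, (i : ℕ) < j → j < i' → h j = j + 2 := fun j hj hj' => by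
      simp only [h]
      split_ifs <;> omega
    have h₄ : h i' = i' + 2 + b := by
      simp only [h]
      split_ifs <;> omega
    have h₅ : ∀ j, (i' : ℕ) < j → h j = j + 4 := fun j hj => by
      simp only [h]
      split_ifs <;> omega
    have hmono := hH (fun j : Fin M => h j) (fun x y hxy => hh hxy) (fun j => by
      have := j.isLt
      simp only [h]
      split_ifs <;> omega)
    have hsplit : ∀ p : Fin M → ℕ, (∀ j, j ≠ i → j ≠ i' → p j = 1) → ∀ x : ℕ,
        ((∃ j : Fin M, x = 2 * e (h j) + p j) ↔
          (∃ j < (i : ℕ), x = 2 * e j + 1) ∨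
          (∃ j, (i : ℕ) < j ∧ j < i' ∧ x = 2 * e (j + 2) + 1) ∨
          (∃ j, (i' : ℕ) < j ∧ j < M ∧ x = 2 * e (j + 4) + 1) ∨
          x = 2 * e (i + a) + p i ∨ x = 2 * e (i' + 2 + b) + p i') := by
      intro p hp x
      constructor
      · rintro ⟨j, hj⟩
        rcases lt_trichotomy j i with hji | rfl | hji
        · rw [hp j hji.ne (hji.trans hlt).ne, h₁ j hji] at hj
          exact Or.inl ⟨j, hji, hj⟩
        · rw [h₂] at hj
          exact Or.inr (Or.inr (Or.inr (Or.inl hj)))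
        · rcases lt_trichotomy j i' with hji' | rfl | hji'
          · rw [hp j hji.ne' hji'.ne, h₃ j hji hji'] at hj
            exact Or.inr (Or.inl ⟨j, hji, hji', hj⟩)
          · rw [h₄] at hj
            exact Or.inr (Or.inr (Or.inr (Or.inr hj)))
          · rw [hp j hji.ne' hji'.ne', h₅ j hji'] at hj
            exact Or.inr (Or.inr (Or.inl ⟨j, hji', j.isLt, hj⟩))
      · rintro (⟨j, hj, hx⟩ | ⟨j, hj, hj', hx⟩ | ⟨j, hj, hj', hx⟩ | hx | hx)
        · refine ⟨⟨j, by omega⟩, ?_⟩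
          rw [hp _ (by simp [Fin.ext_iff]; omega) (by simp [Fin.ext_iff]; omega), h₁ j hj, hx]
        · refine ⟨⟨j, by omega⟩, ?_⟩
          rw [hp _ (by simp [Fin.ext_iff]; omega) (by simp [Fin.ext_iff]; omega), h₃ j hj hj', hx]
        · refine ⟨⟨j, by omega⟩, ?_⟩
          rw [hp _ (by simp [Fin.ext_iff]; omega) (by simp [Fin.ext_iff]; omega), h₅ j hj, hx]
        · exact ⟨i, by rw [h₂, hx]⟩
        · exact ⟨i', by rw [h₄, hx]⟩
    constructor
    · rw [← congrFun hmono i]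
      congr 2
      funext x
      have := hsplit (fun j => if j = i then 0 else 1) (fun j hj _ => if_neg hj) x
      simp only [if_true, if_neg hne.symm, add_zero] at this
      exact propext this.symm
    · rw [hii, ← congrFun hmono i']
      congr 2
      funext x
      have := hsplit (fun j => if j = i' then 0 else 1) (fun j _ hj => if_neg hj) x
      simp only [if_true, if_neg hne, add_zero] at this
      exact propext this.symm
  refine ⟨e i, e (i + 1), e (i + 2), e (i' + 2), e (i' + 3), e (i' + 4),
    fun x => ∃ j < (i : ℕ), x = 2 * e j + 1,
    fun x => ∃ j, (i : ℕ) < j ∧ j < i' ∧ x = 2 * e (j + 2) + 1,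
    fun x => ∃ j, (i' : ℕ) < j ∧ j < M ∧ x = 2 * e (j + 4) + 1,
    he (by omega), he (by omega), he (by omega), he (by omega), he (by omega), ?_, ?_, ?_, ?_,
    H i, fun u hu v hv => ?_⟩
  rotate_right
  · have hu' : ∃ a ≤ 2, u = e (i + a) := by
      simp only [List.mem_cons, List.not_mem_nil, or_false] at hu
      rcases hu with rfl | rfl | rfl
      exacts [⟨0, by omega, rfl⟩, ⟨1, by omega, rfl⟩, ⟨2, by omega, rfl⟩]
    have hv' : ∃ b ≤ 2, v = e (i' + 2 + b) := by
      simp only [List.mem_cons, List.not_mem_nil, or_false] at hv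
      rcases hv with rfl | rfl | rfl
      exacts [⟨0, by omega, rfl⟩, ⟨1, by omega, rfl⟩, ⟨2, by omega, rfl⟩]
    obtain ⟨a, ha, rfl⟩ := hu'
    obtain ⟨b, hb, rfl⟩ := hv'
    exact key a ha b hb
  · have := heR (i' + 4) (by omega)
    omega
  · rintro x ⟨j, hj, rfl⟩
    have := he hj
    omega
  · rintro x ⟨j, hj, hj', rfl⟩
    have h₁ := he (show (i : ℕ) + 2 < j + 2 by omega)
    have h₂ := he (show j + 2 < (i' : ℕ) + 2 by omega)
    omega
  · rintro x ⟨j, hj, -, rfl⟩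
    have := he (show (i' : ℕ) + 4 < j + 4 by omega)
    omega

/-- By Ramsey's theorem, a colouring of sufficiently long words over `{0, 1, 2}` restricts, on words
supported on `m` suitable positions `e 0 < e 1 < ⋯`, to a colouring that depends only on the word
left after deleting `m - L` letters `0`. -/
theorem exists_colour_of_deletion (κ : Type*) [Finite κ] (L m : ℕ) :
    ∃ n : ℕ, ∀ χ : (Fin n → Fin 3) → κ, ∃ e : ℕ → ℕ, StrictMono e ∧ (∀ j < m, e j < n) ∧
      ∃ G : (Fin L → Fin 3) → κ, ∀ V : ℕ → Fin 3, ∀ h : Fin L → ℕ, StrictMono h →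
        (∀ j, h j < m) → (∀ y, (∀ j, h j ≠ y) → V y = 0) →
        χ (fun x => Function.extend e V 0 x) = G (V ∘ h) := by
  obtain ⟨n, hn⟩ := finite_ramsey_strictMono (κ := (Fin L → Fin 3) → κ) L m
  refine ⟨n, fun χ => ?_⟩
  obtain ⟨e, he, hen, G, hG⟩ := hn fun f g => χ fun x => Function.extend f g 0 x
  refine ⟨e, he, hen, G, fun V h hh hhm hV => ?_⟩
  rw [← hG h hh hhm]
  congr 1
  funext x
  have hinj : Function.Injective (e ∘ h) := (he.comp hh).injective
  by_cases hx : ∃ y, e y = x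
  · obtain ⟨y, hy⟩ := hx
    rw [← hy, he.injective.extend_apply]
    by_cases hy' : ∃ j, h j = y
    · obtain ⟨j, rfl⟩ := hy'
      exact (hinj.extend_apply (V ∘ h) 0 j).symm
    · rw [Function.extend_apply' (f := e ∘ h) _ _ _ (fun ⟨j, hj⟩ => hy' ⟨j, he.injective hj⟩)]
      exact hV y (not_exists.1 hy')
  · rw [Function.extend_apply' _ _ _ hx,
      Function.extend_apply' (f := e ∘ h) _ _ _ (fun ⟨j, hj⟩ => hx ⟨h j, hj⟩)]

/-- For every positive `k` there is `n ≥ 1` such that every `k`-colouring of `[3]^n` admits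
positions `i₁ < i₂ < ⋯ < i₆` and fixed values elsewhere so that all six words obtained by
placing the symbols `1, 2, 3` (in any of the six orders) on the blocks
`A = {i₁, i₆}`, `B = {i₂, i₅}`, `C = {i₃, i₄}` receive the same colour: a monochromatic
copy of the template `123` with blocks of size 2 and pattern `ABCCBA`. -/
theorem template123_pattern_ABCCBA (k : ℕ) (hk : 0 < k) :
    ∃ n : ℕ, 0 < n ∧
      ∀ χ : (Fin n → Fin 3) → Fin k,
        ∃ p : Fin 6 → Fin n, StrictMono p ∧
          ∃ a : Fin n → Fin 3,
            ∀ σ σ' : Equiv.Perm (Fin 3), χ (patternWord p a σ) = χ (patternWord p a σ') := by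
  classical
  obtain ⟨L, hL⟩ := exists_monochromatic_indicatorWords (Fin k)
  obtain ⟨n, hn⟩ := exists_colour_of_deletion (Fin k) L (L + 2)
  have hn0 : 0 < n := by
    obtain ⟨e, -, he, -⟩ := hn fun _ => ⟨0, hk⟩
    exact (Nat.zero_le _).trans_lt (he 0 (by omega))
  refine ⟨n, hn0, fun χ => ?_⟩
  obtain ⟨e, he, hen, G, hG⟩ := hn χ
  obtain ⟨t₁, t₂, t₃, t₄, t₅, t₆, Y, X, Z, h₁₂, h₂₃, h₃₄, h₄₅, h₅₆, ht, hY, hX, hZ, col, hcol⟩ :=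
    hL G
  let b : ℕ → Fin 3 := fun y =>
    if L + 2 ≤ y then 0 else if Y y ∨ X (y - 1) ∨ Z (y - 2) then 2 else 1
  let V : Equiv.Perm (Fin 3) → ℕ → Fin 3 := fun σ y =>
    if y = 2 * t₁ ∨ y = 2 * t₆ + 3 then σ 0
    else if y = 2 * t₂ + 1 ∨ y = 2 * t₅ + 2 then σ 1
    else if y = 2 * t₃ + 1 ∨ y = 2 * t₄ + 2 then σ 2
    else b y
  let p : Fin 6 → Fin n :=
    ![⟨e (2 * t₁), hen _ (by omega)⟩, ⟨e (2 * t₂ + 1), hen _ (by omega)⟩,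
      ⟨e (2 * t₃ + 1), hen _ (by omega)⟩, ⟨e (2 * t₄ + 2), hen _ (by omega)⟩,
      ⟨e (2 * t₅ + 2), hen _ (by omega)⟩, ⟨e (2 * t₆ + 3), hen _ (by omega)⟩]
  have hp : StrictMono p := by
    rw [Fin.strictMono_iff_lt_succ]
    intro i
    fin_cases i <;> exact he (by omega)
  have hword : ∀ σ : Equiv.Perm (Fin 3),
      patternWord p (fun x => Function.extend e b 0 x) σ =
        fun x : Fin n => Function.extend e (V σ) 0 x := by
    intro σ
    funext x
    have hpos : ∀ (y : ℕ) (hy : e y < n), x = ⟨e y, hy⟩ ↔ (x : ℕ) = e y :=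
      fun y hy => Fin.ext_iff
    change (if x = ⟨e (2 * t₁), _⟩ ∨ x = ⟨e (2 * t₆ + 3), _⟩ then σ 0
      else if x = ⟨e (2 * t₂ + 1), _⟩ ∨ x = ⟨e (2 * t₅ + 2), _⟩ then σ 1
      else if x = ⟨e (2 * t₃ + 1), _⟩ ∨ x = ⟨e (2 * t₄ + 2), _⟩ then σ 2
      else Function.extend e b 0 x) = _
    simp only [hpos]
    by_cases hx : ∃ y, e y = x
    · obtain ⟨y, hy⟩ := hx
      simp only [← hy, he.injective.extend_apply, he.injective.eq_iff, V]
    · have hne : ∀ y, (x : ℕ) ≠ e y := fun y h => hx ⟨y, h.symm⟩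
      simp [Function.extend_apply' _ _ _ hx, hne]
  have hcolour : ∀ σ : Equiv.Perm (Fin 3),
      χ (patternWord p (fun x => Function.extend e b 0 x) σ) = col := by
    intro σ
    obtain ⟨a, c, hac, hc, ha, hc', u, hu, v, hv, huv⟩ := exists_skipTwo_comp_eq h₁₂ h₂₃ h₃₄ h₄₅ h₅₆
      hY hX hZ ht σ (V σ) (if_pos (by omega))
      ((if_neg (by omega)).trans (if_pos (by omega)))
      ((if_neg (by omega)).trans ((if_neg (by omega)).trans (if_pos (by omega))))
      ((if_neg (by omega)).trans ((if_neg (by omega)).trans (if_pos (by omega))))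
      ((if_neg (by omega)).trans (if_pos (by omega))) (if_pos (by omega))
      (fun y hy h₁ h₂ h₃ h₄ h₅ h₆ => by
        have hVb : V σ y = if Y y ∨ X (y - 1) ∨ Z (y - 2) then 2 else 1 := by
          simp only [V, b]
          rw [if_neg (by omega), if_neg (by omega), if_neg (by omega), if_neg (by omega)]
        rw [hVb]
        exact ⟨fun h => if_pos h, fun h => if_neg h⟩)
    rw [hword, hG (V σ) (fun j => skipTwo a c j) (fun x y hxy => skipTwo_strictMono a c hxy)
      (fun j => skipTwo_lt a c j.isLt)]
    · rcases huv with h | h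
      · exact (congrArg G h).trans (hcol u hu v hv).1
      · exact (congrArg G h).trans (hcol u hu v hv).2
    · intro y hy
      by_cases hyL : y < L + 2
      · by_cases hya : y = a
        · rwa [hya]
        by_cases hyc : y = c
        · rwa [hyc]
        obtain ⟨j, hj, hj'⟩ := exists_skipTwo_eq hc hac hyL hya hyc
        exact absurd hj' (hy ⟨j, hj⟩)
      · simp only [V, b]
        rw [if_neg (by omega), if_neg (by omega), if_neg (by omega), if_pos (by omega)]
  exact ⟨p, hp, fun x => Function.extend e b 0 x, fun σ σ' => (hcolour σ).trans (hcolour σ').symm⟩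
end

section
/- For every positive integer k there exists a positive integer n such that every k-colouring of [3]^n contains a monochromatic block set with template 123 and degree 2. -/
/-- A compact right topological semigroup contains an idempotent `e` such that `e * M * e` is a
group with identity `e`. -/
theorem exists_idempotent_forall_exists_left_inverse {M : Type*} [Nonempty M] [Semigroup M]
    [TopologicalSpace M] [CompactSpace M] [T2Space M]
    (hM : ∀ r : M, Continuous (· * r)) :
    ∃ e : M, e * e = e ∧ ∀ a : M, a * e = a → ∃ b : M, b * a = e := by
  let S : Set (Set M) := {N | IsClosed N ∧ N.Nonempty ∧ ∀ m, ∀ n ∈ N, m * n ∈ N}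
  obtain ⟨N, hN⟩ : ∃ N, Minimal (· ∈ S) N := by
    refine zorn_superset _ fun c hcs hc ↦ ?_
    refine ⟨⋂₀ c, ⟨isClosed_sInter fun t ht ↦ (hcs ht).1, ?_, fun m n hn ↦ ?_⟩,
      fun s hs ↦ Set.sInter_subset_of_mem hs⟩
    · obtain rfl | hne := c.eq_empty_or_nonempty
      · rw [Set.sInter_empty]
        exact Set.univ_nonempty
      · have := hne.to_subtype
        exact IsCompact.nonempty_sInter_of_directed_nonempty_isCompact_isClosed
          (IsChain.directedOn hc.symm) (fun s hs ↦ (hcs hs).2.1)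
          (fun s hs ↦ (hcs hs).1.isCompact) (fun s hs ↦ (hcs hs).1)
    · exact Set.mem_sInter.2 fun t ht ↦ (hcs ht).2.2 m n (Set.mem_sInter.1 hn t ht)
  obtain ⟨hcl, hne, hmul⟩ := hN.prop
  obtain ⟨e, heN, he⟩ := exists_idempotent_in_compact_subsemigroup hM N hne hcl.isCompact
    fun x _ y hy ↦ hmul x y hy
  refine ⟨e, he, fun a ha ↦ ?_⟩
  have haN : a ∈ N := ha ▸ hmul a e heN
  have hrange : Set.range (· * a) = N := by
    refine hN.eq_of_subset ⟨(isCompact_range (hM a)).isClosed, Set.range_nonempty _, ?_⟩ ?_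
    · rintro m _ ⟨n, rfl⟩
      exact ⟨m * n, mul_assoc m n a⟩
    · rintro _ ⟨n, rfl⟩
      exact hmul n a haN
  rw [← hrange] at heN
  exact heN

/-- A word in which each of three variables occurs twice, whose value in a group is the same for
all six ways of substituting three given elements for the variables. -/
theorem mul_perm_three_eq {G : Type*} [Group G] (a : Fin 3 → G) (σ : Equiv.Perm (Fin 3)) :
    a (σ 0) * (a 0)⁻¹ * a (σ 1) * (a 0)⁻¹ * a (σ 2) * ((a 2)⁻¹ * a 0 * (a 1)⁻¹) *
      a (σ 2) * (a 0)⁻¹ * a (σ 1) * (a 0)⁻¹ * a (σ 0) = a 2 * (a 0)⁻¹ * a 1 := by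
  have h01 : σ 0 ≠ σ 1 := by simp
  have h02 : σ 0 ≠ σ 2 := by simp
  have h12 : σ 1 ≠ σ 2 := by simp
  generalize σ 0 = x at *
  generalize σ 1 = y at *
  generalize σ 2 = z at *
  fin_cases x <;> fin_cases y <;> fin_cases z <;> simp at h01 h02 h12 ⊢ <;> group

attribute [local instance] Ultrafilter.semigroup

/-- There are ultrafilters `p`, `e`, `u`, `v` such that the products obtained from `e, u, v` by
inserting the letters `s (σ 0), s (σ 1), s (σ 2), s (σ 2), s (σ 1), s (σ 0)` all equal `p`. -/
theorem exists_ultrafilter_mul_perm_three_eq {M : Type*} [Nonempty M] [Semigroup M]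
    (s : Fin 3 → Ultrafilter M) :
    ∃ p e u v : Ultrafilter M, ∀ σ : Equiv.Perm (Fin 3),
      e * (s (σ 0) * (u * (s (σ 1) * (u * (s (σ 2) * (v * (s (σ 2) * (u * (s (σ 1) *
        (u * (s (σ 0) * e))))))))))) = p := by
  obtain ⟨e, he, hinv⟩ := exists_idempotent_forall_exists_left_inverse
    (M := Ultrafilter M) Ultrafilter.continuous_mul_left
  have he' (x : Ultrafilter M) : e * (e * x) = e * x := by rw [← mul_assoc, he]
  let H := {x : Ultrafilter M // e * x = x ∧ x * e = x}
  have hinv' (x : H) : ∃ y : H, y.1 * x.1 = e := by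
    obtain ⟨b, hb⟩ := hinv x.1 x.2.2
    refine ⟨⟨e * b * e, by simp only [mul_assoc, he'], by simp only [mul_assoc, he]⟩, ?_⟩
    simp only [mul_assoc, x.2.1, hb, he]
  choose inv h_inv using hinv'
  let _ : Mul H := ⟨fun x y ↦ ⟨x.1 * y.1, by rw [← mul_assoc, x.2.1], by rw [mul_assoc, y.2.2]⟩⟩
  let _ : One H := ⟨⟨e, he, he⟩⟩
  let _ : Inv H := ⟨inv⟩
  let _ : Group H := Group.ofLeftAxioms (fun x y z ↦ Subtype.ext (mul_assoc x.1 y.1 z.1))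
    (fun x ↦ Subtype.ext x.2.1) (fun x ↦ Subtype.ext (h_inv x))
  have hcoe (x y : H) : (x * y).1 = x.1 * y.1 := rfl
  let a (i : Fin 3) : H :=
    ⟨e * s i * e, by simp only [mul_assoc, he'], by simp only [mul_assoc, he]⟩
  refine ⟨(a 2 * (a 0)⁻¹ * a 1).1, e, e * (a 0)⁻¹.1 * e,
    e * ((a 2)⁻¹ * a 0 * (a 1)⁻¹).1 * e, fun σ ↦ ?_⟩
  rw [← mul_perm_three_eq a σ]
  generalize (a 2)⁻¹ * a 0 * (a 1)⁻¹ = v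
  generalize (a 0)⁻¹ = u
  simp only [hcoe, a, mul_assoc]

/-- For every finite colouring of a semigroup with three given elements, there are six products
with the given elements inserted in all possible orders which have the same colour. -/
theorem exists_color_mul_perm_three_eq {M κ : Type*} [Nonempty M] [Semigroup M] [Finite κ]
    (c : M → κ) (s : Fin 3 → M) :
    ∃ (w₀ w₁ w₂ w₃ w₄ w₅ w₆ : M) (i : κ), ∀ σ : Equiv.Perm (Fin 3),
      c (w₀ * (s (σ 0) * (w₁ * (s (σ 1) * (w₂ * (s (σ 2) * (w₃ * (s (σ 2) * (w₄ * (s (σ 1) *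
        (w₅ * (s (σ 0) * w₆)))))))))))) = i := by
  obtain ⟨p, e, u, v, h⟩ :=
    exists_ultrafilter_mul_perm_three_eq fun i ↦ (pure (s i) : Ultrafilter M)
  obtain ⟨i, hi⟩ : ∃ i, ∀ᶠ m in p, c m = i :=
    Ultrafilter.eventually_exists_iff.1 (.of_forall fun m ↦ ⟨c m, rfl⟩)
  have key (σ : Equiv.Perm (Fin 3)) := by
    have := hi
    rw [← h σ] at this
    simp only [Ultrafilter.eventually_mul, Ultrafilter.coe_pure, Filter.eventually_pure] at this
    exact this
  obtain ⟨w₀, key⟩ := (Filter.eventually_all.2 key).exists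
  obtain ⟨w₁, key⟩ := (Filter.eventually_all.2 key).exists
  obtain ⟨w₂, key⟩ := (Filter.eventually_all.2 key).exists
  obtain ⟨w₃, key⟩ := (Filter.eventually_all.2 key).exists
  obtain ⟨w₄, key⟩ := (Filter.eventually_all.2 key).exists
  obtain ⟨w₅, key⟩ := (Filter.eventually_all.2 key).exists
  obtain ⟨w₆, key⟩ := (Filter.eventually_all.2 key).exists
  exact ⟨w₀, w₁, w₂, w₃, w₄, w₅, w₆, i, key⟩

/-- A list over `Fin m ⊕ Fin l` in which every variable `Sum.inr j` occurs exactly `d` times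
spans a block set. If all permutations of the variables give lists of the same colour, the block
set is monochromatic. -/
theorem exists_isBlockSet_monochromatic_of_list {m d : ℕ} {κ : Type*} [NeZero m]
    (χ : ∀ n : ℕ, (Fin n → Fin m) → κ) (L : List (Fin m ⊕ Fin m))
    (hL : ∀ j : Fin m, L.countP (· = Sum.inr j) = d) (i₀ : κ)
    (h : ∀ σ : Equiv.Perm (Fin m), χ _ (L.map (Sum.elim id σ)).get = i₀) :
    ∃ B : Set (Fin L.length → Fin m),
      IsBlockSet (fun j : Fin m => j) d B ∧ Monochromatic (χ L.length) B := by
  have hχ {n : ℕ} (l : List (Fin m)) (w : Fin n → Fin m) (hl : l = List.ofFn w) :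
      χ _ l.get = χ n w := by
    have hn : l.length = n := by simp [hl]
    subst hn
    congr 1
    rw [← List.ofFn_inj, ← hl, List.ofFn_get]
  refine ⟨_, ⟨fun j ↦ {i | L.get i = Sum.inr j}, fun i ↦ Sum.elim id (fun _ ↦ 0) (L.get i),
    fun j j' hj ↦ ?_, fun j ↦ ?_, rfl⟩, ?_⟩
  · rw [Finset.disjoint_left]
    intro i hi hi'
    simp only [Finset.mem_filter, Finset.mem_univ, true_and] at hi hi'
    exact hj (Sum.inr_injective (hi.symm.trans hi'))
  · rw [← hL j]
    let _ : BEq (Fin m ⊕ Fin m) := instBEqOfDecidableEq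
    exact Fin.card_filter_univ_eq_vector_get_eq_count (Sum.inr j) ⟨L, rfl⟩
  · suffices hw : ∀ w ∈ _, χ L.length w = i₀ from fun w hw₁ w' hw₂ ↦
      (hw w hw₁).trans (hw w' hw₂).symm
    rintro w ⟨hfix, σ, hσ⟩
    rw [← h σ]
    refine (hχ _ _ ?_).symm
    have hw : w = fun i ↦ Sum.elim id σ (L.get i) := by
      funext i
      rcases hi : L.get i with t | j
      · have := hfix i fun j ↦ by simp [hi, -List.get_eq_getElem]
        simpa only [hi, Sum.elim_inl, id_eq] using this
      · exact hσ j i (by simp [hi, -List.get_eq_getElem])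
    rw [hw]
    conv_lhs => rw [← List.ofFn_get L]
    rw [List.map_ofFn]
    rfl

/-- For every positive integer `k` there exists `n ≥ 1` such that every `k`-colouring of
`[3]^n` contains a monochromatic block set with template `123` and degree `2`. -/
theorem template123_degree_two (k : ℕ) (hk : 0 < k) :
    ∃ n : ℕ, 0 < n ∧
      ∀ χ : (Fin n → Fin 3) → Fin k,
        ∃ B : Set (Fin n → Fin 3),
          IsBlockSet (fun j : Fin 3 => j) 2 B ∧ Monochromatic χ B := by
  by_contra! hbad
  have hbad' (n : ℕ) : ∃ χ : (Fin n → Fin 3) → Fin k, 0 < n → ∀ B : Set (Fin n → Fin 3),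
      IsBlockSet (fun j : Fin 3 => j) 2 B → ¬ Monochromatic χ B := by
    rcases Nat.eq_zero_or_pos n with rfl | hn
    · exact ⟨fun _ ↦ ⟨0, hk⟩, fun h ↦ absurd h (lt_irrefl 0)⟩
    · obtain ⟨χ, hχ⟩ := hbad n hn
      exact ⟨χ, fun _ ↦ hχ⟩
  choose χ hχ using hbad'
  obtain ⟨w₀, w₁, w₂, w₃, w₄, w₅, w₆, i, h⟩ := exists_color_mul_perm_three_eq
    (fun w : FreeMonoid (Fin 3) ↦ χ _ w.toList.get) FreeMonoid.of
  let f (w : FreeMonoid (Fin 3)) : List (Fin 3 ⊕ Fin 3) := w.toList.map Sum.inl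
  let L : List (Fin 3 ⊕ Fin 3) := f w₀ ++ (Sum.inr 0 :: (f w₁ ++ (Sum.inr 1 :: (f w₂ ++
    (Sum.inr 2 :: (f w₃ ++ (Sum.inr 2 :: (f w₄ ++ (Sum.inr 1 :: (f w₅ ++
      (Sum.inr 0 :: f w₆)))))))))))
  have hf (w : FreeMonoid (Fin 3)) (j : Fin 3) : (f w).countP (· = Sum.inr j) = 0 :=
    List.countP_eq_zero.2 (by simp [f])
  obtain ⟨B, hB, hmono⟩ := exists_isBlockSet_monochromatic_of_list (d := 2) χ L
    (fun j ↦ by fin_cases j <;> simp [L, hf]) i fun σ ↦ by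
      rw [← h σ]
      have : L.map (Sum.elim id σ) = FreeMonoid.toList (w₀ * (FreeMonoid.of (σ 0) * (w₁ *
          (FreeMonoid.of (σ 1) * (w₂ * (FreeMonoid.of (σ 2) * (w₃ * (FreeMonoid.of (σ 2) * (w₄ *
          (FreeMonoid.of (σ 1) * (w₅ * (FreeMonoid.of (σ 0) * w₆)))))))))))) := by
        simp [L, f, FreeMonoid.toList_mul, FreeMonoid.toList_of]
      rw [this]
  exact hχ L.length (by simp [L]) B hB hmono
end

section
/- For all positive integers k and q there exists a positive integer n such that every k-colouring of [3]^n contains a monochromatic block set of degree 2 with the template over [3] consisting of one 1, one 2, and q copies of 3. -/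
/-- The template over `[3]` consisting of one `1`, one `2` and `q` copies of `3`. -/
def template12Q (q : ℕ) : Fin (2 + q) → Fin 3 :=
  fun j => if (j : ℕ) = 0 then 0 else if (j : ℕ) = 1 then 1 else 2

/-- The `r`-th letter of the alternating word `1 2 1 2 ⋯` whose `s`-th pair `1 2` is replaced by
`2 1`. -/
def flipLetter (s r : ℕ) : Fin 3 :=
  if (r + if r / 2 = s then 1 else 0) % 2 = 0 then 0 else 1

/-- The word which is `3` outside `P` and spells the alternating word with its `s`-th pair flipped
along `P`. -/
def sparseWord (P : Finset ℕ) (s i : ℕ) : Fin 3 :=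
  if i ∈ P then flipLetter s (P.filter (· < i)).card else 2

theorem sparseWord_image {h : ℕ → ℕ} {m : ℕ} (hh : StrictMonoOn h (Set.Iio m)) (s : ℕ) {r : ℕ}
    (hr : r < m) : sparseWord ((Finset.range m).image h) s (h r) = flipLetter s r := by
  have hfilter : ((Finset.range m).image h).filter (· < h r) = (Finset.range r).image h := by
    ext y
    simp only [Finset.mem_filter, Finset.mem_image, Finset.mem_range]
    constructor
    · rintro ⟨⟨u, hu, rfl⟩, hlt⟩
      exact ⟨u, (hh.lt_iff_lt hu hr).1 hlt, rfl⟩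
    · rintro ⟨u, hu, rfl⟩
      exact ⟨⟨u, hu.trans hr, rfl⟩, hh (hu.trans hr) hr hu⟩
  have hcard : ((Finset.range r).image h).card = r := by
    rw [Finset.card_image_of_injOn, Finset.card_range]
    intro u hu v hv huv
    simp only [Finset.coe_range, Set.mem_Iio] at hu hv
    exact hh.injOn (hu.trans hr) (hv.trans hr) huv
  rw [sparseWord, if_pos (Finset.mem_image_of_mem h (Finset.mem_range.2 hr)), hfilter, hcard]

theorem Ultrafilter.exists_eventually_eq {α K : Type*} [Finite K] (U : Ultrafilter α) (g : α → K) :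
    ∃ a, ∀ᶠ y in (U : Filter α), g y = a := by
  obtain ⟨a, ha⟩ := Ultrafilter.eq_pure_of_finite (U.map g)
  refine ⟨a, ?_⟩
  have : ({a} : Set K) ∈ U.map g := by rw [ha]; exact Set.mem_singleton a
  exact this

/-- Ramsey's theorem for `m`-element sets of natural numbers, with long finite homogeneous sets. -/
theorem exists_strictMonoOn_homogeneous {K : Type*} [Finite K] (m : ℕ) (f : Finset ℕ → K) :
    ∃ a, ∀ M, ∃ x : ℕ → ℕ, StrictMonoOn x (Set.Iio M) ∧
      ∀ P ⊆ (Finset.range M).image x, P.card = m → f P = a := by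
  choose L hL using (Filter.hyperfilter ℕ).exists_eventually_eq (K := K)
  let F : ℕ → Finset ℕ → K := fun d =>
    Nat.rec f (fun _ G P => L fun y => G (insert y P)) d
  have hF : ∀ d P, F (d + 1) P = L fun y => F d (insert y P) := fun _ _ => rfl
  suffices H : ∀ M, ∃ x : ℕ → ℕ, StrictMonoOn x (Set.Iio M) ∧
      ∀ P ⊆ (Finset.range M).image x, ∀ d, d + P.card = m → F d P = F m ∅ by
    refine ⟨F m ∅, fun M => ?_⟩
    obtain ⟨x, hx, hP⟩ := H M
    exact ⟨x, hx, fun P hPx hc => hP P hPx 0 (by omega)⟩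
  intro M
  induction M with
  | zero =>
    refine ⟨id, fun i hi => by simp at hi, fun P hP d hd => ?_⟩
    obtain rfl : P = ∅ := by simpa using hP
    obtain rfl : d = m := by simpa using hd
    rfl
  | succ M ih =>
    obtain ⟨x, hx, hP⟩ := ih
    have h1 : ∀ᶠ y in (Filter.hyperfilter ℕ : Filter ℕ), ∀ i ∈ Finset.range M, x i < y := by
      rw [Finset.eventually_all]
      intro i _
      exact (Nat.hyperfilter_le_atTop) (Filter.eventually_gt_atTop (x i))
    have h2 : ∀ᶠ y in (Filter.hyperfilter ℕ : Filter ℕ),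
        ∀ P ∈ ((Finset.range M).image x).powerset, ∀ d ∈ Finset.range (m + 1),
          F d (insert y P) = F (d + 1) P := by
      rw [Finset.eventually_all]
      intro P _
      rw [Finset.eventually_all]
      intro d _
      exact hL fun y => F d (insert y P)
    obtain ⟨y, hy1, hy2⟩ := (h1.and h2).exists
    have hxlt : ∀ i, i < M → Function.update x M y i = x i := fun i hi =>
      Function.update_of_ne hi.ne _ _
    refine ⟨Function.update x M y, ?_, ?_⟩
    · intro i hi j hj hij
      simp only [Set.mem_Iio] at hi hj
      have hiM : i < M := by omega
      rw [hxlt i hiM]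
      rcases Nat.lt_succ_iff_lt_or_eq.1 hj with hjM | rfl
      · rw [hxlt j hjM]
        exact hx hiM hjM hij
      · rw [Function.update_self]
        exact hy1 i (Finset.mem_range.2 hiM)
    · intro P hPsub d hd
      have himage : (Finset.range (M + 1)).image (Function.update x M y)
          = insert y ((Finset.range M).image x) := by
        rw [Finset.range_add_one, Finset.image_insert, Function.update_self]
        congr 1
        exact Finset.image_congr fun i hi => hxlt i (by simpa using hi)
      rw [himage] at hPsub
      by_cases hyP : y ∈ P
      · have hsub : P.erase y ⊆ (Finset.range M).image x := by
          rwa [← Finset.subset_insert_iff]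
        have hc := Finset.card_erase_add_one hyP
        rw [← hP _ hsub (d + 1) (by omega),
          ← hy2 _ (Finset.mem_powerset.2 hsub) d (Finset.mem_range.2 (by omega)),
          Finset.insert_erase hyP]
      · exact hP P ((Finset.subset_insert_iff_of_notMem hyP).1 hPsub) d hd

/-- Finite Ramsey theorem for `m`-element sets, for a sequence of colourings. -/
theorem exists_homogeneous_of_sequence {K : Type*} [Finite K] (m M : ℕ) (f : ℕ → Finset ℕ → K) :
    ∃ n, ∃ x : ℕ → ℕ, 0 < n ∧ StrictMonoOn x (Set.Iio M) ∧ (∀ i < M, x i < n) ∧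
      ∃ a, ∀ P ⊆ (Finset.range M).image x, P.card = m → f n P = a := by
  choose g hg using fun P => (Filter.hyperfilter ℕ).exists_eventually_eq (fun n => f n P)
  obtain ⟨a, ha⟩ := exists_strictMonoOn_homogeneous m g
  obtain ⟨x, hx, hP⟩ := ha M
  have h1 : ∀ᶠ n in (Filter.hyperfilter ℕ : Filter ℕ), ∀ i ∈ Finset.range M, x i < n := by
    rw [Finset.eventually_all]
    intro i _
    exact (Nat.hyperfilter_le_atTop) (Filter.eventually_gt_atTop (x i))
  have h2 : ∀ᶠ n in (Filter.hyperfilter ℕ : Filter ℕ),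
      ∀ P ∈ ((Finset.range M).image x).powerset, f n P = g P := by
    rw [Finset.eventually_all]
    exact fun P _ => hg P
  have h3 : ∀ᶠ n in (Filter.hyperfilter ℕ : Filter ℕ), 0 < n :=
    (Nat.hyperfilter_le_atTop) (Filter.eventually_gt_atTop 0)
  obtain ⟨n, hn1, hn2, hn3⟩ := (h1.and (h2.and h3)).exists
  exact ⟨n, x, hn3, hx, fun i hi => hn1 i (Finset.mem_range.2 hi), a, fun P hPx hc =>
    (hn2 P (Finset.mem_powerset.2 hPx)).trans (hP P hPx hc)⟩

/-- The letters of the frame of the block set: alternating letters, interrupted by two intervals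
of length `l` reserved for the blocks. -/
def frameLetter (s t l i : ℕ) : Fin 3 :=
  if i < 2 * s then (if i % 2 = 0 then 0 else 1)
  else if i < 2 * s + l then 2
  else if i < 2 * t + l - 2 then (if (i - l) % 2 = 0 then 0 else 1)
  else if i < 2 * t + 2 * l - 2 then 2
  else (if (i - 2 * l) % 2 = 0 then 0 else 1)

/-- Where the `r`-th letter of the alternating word is placed, when the blocks `lo < hi` receive
the letters `1` and `2` in some order. -/
def slot (s t l lo hi r : ℕ) : ℕ :=
  if r < 2 * s then r
  else if r = 2 * s then 2 * s + lo
  else if r = 2 * s + 1 then 2 * s + hi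
  else if r < 2 * t then r + l - 2
  else if r = 2 * t then 2 * t + 2 * l - 3 - hi
  else if r = 2 * t + 1 then 2 * t + 2 * l - 3 - lo
  else r + 2 * l - 4

theorem slot_strictMono {s t l lo hi : ℕ} (hst : s < t) (hlo : lo < hi) (hhi : hi < l) :
    StrictMono (slot s t l lo hi) := by
  refine strictMono_nat_of_lt_succ fun r => ?_
  unfold slot
  split_ifs <;> omega

theorem slot_lt {s t k l lo hi r : ℕ} (hst : s < t) (htk : t ≤ k) (hlo : lo < hi) (hhi : hi < l)
    (hr : r < 2 * k + 2) : slot s t l lo hi r < 2 * k + 2 * l - 2 := by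
  unfold slot
  split_ifs <;> omega

/-- An index word that agrees with the frame off the blocks and carries `1` and `2` on two distinct
blocks spells the alternating word flipped at `t` or at `s` along `slot`. -/
theorem eq_flipLetter_of_slot {s t l p p' : ℕ} (hst : s < t) (hp : p < l) (hp' : p' < l)
    (hpp : p ≠ p') {Z : ℕ → Fin 3} {V : ℕ → Fin 3} (hV0 : V p = 0) (hV1 : V p' = 1)
    (hZf : ∀ i, (∀ j < l, i ≠ 2 * s + j ∧ i ≠ 2 * t + 2 * l - 3 - j) → Z i = frameLetter s t l i)
    (hZl : ∀ j < l, Z (2 * s + j) = V j) (hZr : ∀ j < l, Z (2 * t + 2 * l - 3 - j) = V j) (r : ℕ) :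
    Z (slot s t l (min p p') (max p p') r) = flipLetter (if p < p' then t else s) r := by
  have hlt : min p p' < max p p' := by omega
  have hml : max p p' < l := by omega
  obtain ⟨u, hu⟩ : ∃ u, u = if p < p' then t else s := ⟨_, rfl⟩
  have hV : (u = t ∧ V (min p p') = 0 ∧ V (max p p') = 1) ∨
      (u = s ∧ V (min p p') = 1 ∧ V (max p p') = 0) := by
    split_ifs at hu with h
    · rw [min_eq_left h.le, max_eq_right h.le]
      exact Or.inl ⟨hu, hV0, hV1⟩
    · rw [min_eq_right (by omega), max_eq_left (by omega)]
      exact Or.inr ⟨hu, hV1, hV0⟩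
  rw [← hu]
  clear hu
  generalize min p p' = lo at *
  generalize max p p' = hi at *
  obtain ⟨lhs, hlhs⟩ : ∃ i, i = slot s t l lo hi r := ⟨_, rfl⟩
  rw [← hlhs]
  unfold slot at hlhs
  split_ifs at hlhs with h1 h2 h3 h4 h5 h6 <;> subst hlhs
  · rw [hZf _ (fun j hj => by omega)]
    unfold frameLetter flipLetter
    rcases hV with ⟨rfl, -, -⟩ | ⟨rfl, -, -⟩ <;>
      (split_ifs <;> first | rfl | omega)
  · rw [hZl _ (by omega)]
    unfold flipLetter
    rcases hV with ⟨rfl, hV, hV'⟩ | ⟨rfl, hV, hV'⟩ <;> rw [hV] <;>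
      (split_ifs <;> first | rfl | omega)
  · rw [hZl _ (by omega)]
    unfold flipLetter
    rcases hV with ⟨rfl, hV, hV'⟩ | ⟨rfl, hV, hV'⟩ <;> rw [hV'] <;>
      (split_ifs <;> first | rfl | omega)
  · rw [hZf _ (fun j hj => by omega)]
    unfold frameLetter flipLetter
    rcases hV with ⟨rfl, -, -⟩ | ⟨rfl, -, -⟩ <;>
      (split_ifs <;> first | rfl | omega)
  · rw [hZr _ (by omega)]
    unfold flipLetter
    rcases hV with ⟨rfl, hV, hV'⟩ | ⟨rfl, hV, hV'⟩ <;> rw [hV'] <;>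
      (split_ifs <;> first | rfl | omega)
  · rw [hZr _ (by omega)]
    unfold flipLetter
    rcases hV with ⟨rfl, hV, hV'⟩ | ⟨rfl, hV, hV'⟩ <;> rw [hV] <;>
      (split_ifs <;> first | rfl | omega)
  · rw [hZf _ (fun j hj => by omega)]
    unfold frameLetter flipLetter
    rcases hV with ⟨rfl, -, -⟩ | ⟨rfl, -, -⟩ <;>
      (split_ifs <;> first | rfl | omega)

theorem exists_block_of_ne_slot {s t k l p p' i : ℕ} (hst : s < t) (htk : t ≤ k) (hp : p < l)
    (hp' : p' < l) (hpp : p ≠ p') (hi : i < 2 * k + 2 * l - 2)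
    (h : ∀ r < 2 * k + 2, slot s t l (min p p') (max p p') r ≠ i) :
    ∃ j < l, j ≠ p ∧ j ≠ p' ∧ (i = 2 * s + j ∨ i = 2 * t + 2 * l - 3 - j) := by
  have hlt : min p p' < max p p' := by omega
  have hml : max p p' < l := by omega
  have hcases : (min p p' = p ∧ max p p' = p') ∨ (min p p' = p' ∧ max p p' = p) := by omega
  generalize min p p' = lo at *
  generalize max p p' = hi at *
  have e1 : 2 * s + lo ≠ i := fun hh =>
    h (2 * s) (by omega) (by unfold slot; split_ifs <;> omega)
  have e2 : 2 * s + hi ≠ i := fun hh =>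
    h (2 * s + 1) (by omega) (by unfold slot; split_ifs <;> omega)
  have e3 : 2 * t + 2 * l - 3 - hi ≠ i := fun hh =>
    h (2 * t) (by omega) (by unfold slot; split_ifs <;> omega)
  have e4 : 2 * t + 2 * l - 3 - lo ≠ i := fun hh =>
    h (2 * t + 1) (by omega) (by unfold slot; split_ifs <;> omega)
  by_cases c1 : i < 2 * s
  · exact absurd (by unfold slot; split_ifs <;> omega)
      (h (i) (by omega))
  by_cases c2 : i < 2 * s + l
  · exact ⟨i - 2 * s, by omega, by omega, by omega, by omega⟩
  by_cases c3 : i < 2 * t + l - 2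
  · exact absurd (by unfold slot; split_ifs <;> omega)
      (h (i + 2 - l) (by omega))
  by_cases c4 : i < 2 * t + 2 * l - 2
  · exact ⟨2 * t + 2 * l - 3 - i, by omega, by omega, by omega, by omega⟩
  · exact absurd (by unfold slot; split_ifs <;> omega)
      (h (i + 4 - 2 * l) (by omega))

theorem exists_template12Q_blockSet {n k q s t : ℕ} {x : ℕ → ℕ} (hst : s < t) (htk : t ≤ k)
    (hx : StrictMonoOn x (Set.Iio (2 * k + 2 * q + 2)))
    (hxn : ∀ i < 2 * k + 2 * q + 2, x i < n) :
    ∃ B : Set (Fin n → Fin 3), IsBlockSet (template12Q q) 2 B ∧ ∀ w ∈ B,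
      ∃ P ⊆ (Finset.range (2 * k + 2 * q + 2)).image x, P.card = 2 * k + 2 ∧
        ∃ u, (u = s ∨ u = t) ∧ w = fun i : Fin n => sparseWord P u i := by
  obtain ⟨l, hl⟩ : ∃ l, l = 2 + q := ⟨_, rfl⟩
  obtain ⟨M, hM⟩ : ∃ M, M = 2 * k + 2 * q + 2 := ⟨_, rfl⟩
  rw [← hM] at hx hxn ⊢
  have hn : 0 < n := by
    have := hxn 0 (by omega)
    omega
  let y : ℕ → Fin n := fun i => if h : x i < n then ⟨x i, h⟩ else ⟨0, hn⟩
  have hy : ∀ i < M, (y i : ℕ) = x i := fun i hi => by simp [y, hxn i hi]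
  have hyinj : ∀ i < M, ∀ j < M, y i = y j → i = j := fun i hi j hj hij =>
    hx.injOn hi hj (by rw [← hy i hi, ← hy j hj, hij])
  let I : Fin (2 + q) → Finset (Fin n) := fun j =>
    {y (2 * s + j), y (2 * t + 2 * l - 3 - j)}
  let a : Fin n → Fin 3 := fun i => open Classical in
    if h : ∃ j < M, y j = i then frameLetter s t l h.choose else 2
  have ha : ∀ i < M, a (y i) = frameLetter s t l i := by
    intro i hi
    have h : ∃ j < M, y j = y i := ⟨i, hi, rfl⟩
    simp only [a, dif_pos h]
    rw [hyinj _ h.choose_spec.1 _ hi h.choose_spec.2]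
  refine ⟨_, ⟨I, a, ?_, ?_, rfl⟩, ?_⟩
  · intro j j' hjj
    have hne : (j : ℕ) ≠ j' := fun h => hjj (Fin.ext h)
    have := j.2
    have := j'.2
    rw [Finset.disjoint_left]
    intro i hi hi'
    simp only [I, Finset.mem_insert, Finset.mem_singleton] at hi hi'
    rcases hi with rfl | rfl <;> rcases hi' with h | h <;>
      · have := hyinj _ (by omega) _ (by omega) h
        omega
  · intro j
    have := j.2
    refine Finset.card_pair fun h => ?_
    have := hyinj _ (by omega) _ (by omega) h
    omega
  · rintro w ⟨hwa, σ, hσ⟩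
    obtain ⟨p, hp⟩ : ∃ p, p = σ.symm ⟨0, by omega⟩ := ⟨_, rfl⟩
    obtain ⟨p', hp'⟩ : ∃ p', p' = σ.symm ⟨1, by omega⟩ := ⟨_, rfl⟩
    have hσp : (σ p : ℕ) = 0 := by simp [hp]
    have hσp' : (σ p' : ℕ) = 1 := by simp [hp']
    have hpp : (p : ℕ) ≠ p' := fun h => by
      rw [Fin.ext h] at hσp
      omega
    have hpl : (p : ℕ) < l := by omega
    have hpl' : (p' : ℕ) < l := by omega
    have hmono := slot_strictMono (l := l) (lo := min (p : ℕ) p') (hi := max (p : ℕ) p') hst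
      (by omega) (by omega)
    have hslot : ∀ r < 2 * k + 2, slot s t l (min (p : ℕ) p') (max (p : ℕ) p') r < M :=
      fun r hr => by
        have := slot_lt (l := l) (lo := min (p : ℕ) p') (hi := max (p : ℕ) p') hst htk
          (by omega) (by omega) hr
        omega
    have hframe : ∀ i < M, (∀ j < l, i ≠ 2 * s + j ∧ i ≠ 2 * t + 2 * l - 3 - j) →
        w (y i) = frameLetter s t l i := by
      intro i hi hij
      rw [hwa, ha i hi]
      intro j hj
      have := hij j (by omega)
      have := j.2
      simp only [I, Finset.mem_insert, Finset.mem_singleton] at hj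
      rcases hj with hj | hj <;>
        · have := hyinj _ hi _ (by omega) hj
          omega
    have hblock : ∀ j (hj : j < l), w (y (2 * s + j)) = template12Q q (σ ⟨j, by omega⟩) ∧
        w (y (2 * t + 2 * l - 3 - j)) = template12Q q (σ ⟨j, by omega⟩) := fun j hj =>
      ⟨hσ _ _ (by simp [I]), hσ _ _ (by simp [I])⟩
    have hletter := eq_flipLetter_of_slot (Z := fun i => if i < M then w (y i) else
        frameLetter s t l i)
      (V := fun j => if h : j < 2 + q then template12Q q (σ ⟨j, h⟩) else 2) hst hpl hpl' hpp
      (by simp [template12Q, hσp]) (by simp [template12Q, hσp'])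
      (fun i hi => by
        split_ifs with h
        · exact hframe i h hi
        · rfl)
      (fun j hj => by
        rw [if_pos (by omega), dif_pos (by omega), (hblock j hj).1])
      (fun j hj => by
        rw [if_pos (by omega), dif_pos (by omega), (hblock j hj).2])
    have hnone := fun i => exists_block_of_ne_slot (i := i) hst htk hpl hpl' hpp
    generalize slot s t l (min (p : ℕ) p') (max (p : ℕ) p') = h at *
    have hxh : StrictMonoOn (x ∘ h) (Set.Iio (2 * k + 2)) := fun r hr r' hr' hrr =>
      hx (hslot r hr) (hslot r' hr') (hmono hrr)
    refine ⟨(Finset.range (2 * k + 2)).image (x ∘ h), ?_, ?_, if (p : ℕ) < p' then t else s, ?_, ?_⟩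
    · intro v hv
      obtain ⟨r, hr, rfl⟩ := Finset.mem_image.1 hv
      exact Finset.mem_image_of_mem x (Finset.mem_range.2 (hslot r (Finset.mem_range.1 hr)))
    · rw [Finset.card_image_of_injOn, Finset.card_range]
      simpa only [Finset.coe_range] using hxh.injOn
    · split_ifs
      · exact Or.inr rfl
      · exact Or.inl rfl
    · funext i
      by_cases hi : ∃ r < 2 * k + 2, y (h r) = i
      · obtain ⟨r, hr, rfl⟩ := hi
        have hw := hletter r
        simp only [if_pos (hslot r hr)] at hw
        rw [hw, hy _ (hslot r hr)]
        exact (sparseWord_image hxh _ hr).symm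
      · have hiP : (i : ℕ) ∉ (Finset.range (2 * k + 2)).image (x ∘ h) := by
          intro hiP
          obtain ⟨r, hr, hri⟩ := Finset.mem_image.1 hiP
          have hr := Finset.mem_range.1 hr
          exact hi ⟨r, hr, Fin.ext ((hy _ (hslot r hr)).trans hri)⟩
        rw [sparseWord, if_neg hiP]
        by_cases hiM : ∃ u < M, y u = i
        · obtain ⟨u, hu, rfl⟩ := hiM
          obtain ⟨j, hj, hjp, hjp', hju⟩ := hnone u (by omega) fun r hr hru =>
            hi ⟨r, hr, by rw [hru]⟩
          have hT : template12Q q (σ ⟨j, by omega⟩) = 2 := by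
            rw [template12Q, if_neg, if_neg]
            · rw [← hσp', Fin.val_inj, σ.injective.eq_iff]
              exact fun h => hjp' (congrArg Fin.val h)
            · rw [← hσp, Fin.val_inj, σ.injective.eq_iff]
              exact fun h => hjp (congrArg Fin.val h)
          rw [← hT]
          rcases hju with rfl | rfl
          exacts [(hblock j hj).1, (hblock j hj).2]
        · rw [hwa]
          · exact dif_neg hiM
          · intro j hj
            have := j.2
            simp only [I, Finset.mem_insert, Finset.mem_singleton] at hj
            rcases hj with rfl | rfl <;> exact hiM ⟨_, by omega, rfl⟩

/-- For all positive integers `k` and `q` there exists `n ≥ 1` such that every `k`-colouring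
of `[3]^n` contains a monochromatic block set of degree `2` with template
`1 2 3 ⋯ 3` (`q` threes). -/
theorem template12QQQ_degree_two (k q : ℕ) (hk : 0 < k) (hq : 0 < q) :
    ∃ n : ℕ, 0 < n ∧
      ∀ χ : (Fin n → Fin 3) → Fin k,
        ∃ B : Set (Fin n → Fin 3),
          IsBlockSet (template12Q q) 2 B ∧ Monochromatic χ B := by
  by_contra! H
  choose χ hχ using H
  obtain ⟨n, x, hn, hx, hxn, g, hg⟩ := exists_homogeneous_of_sequence (K := Fin (k + 1) → Fin k)
    (2 * k + 2) (2 * k + 2 * q + 2) fun n P u =>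
      if hn : 0 < n then χ n hn fun i => sparseWord P u i else ⟨0, hk⟩
  simp only [dif_pos hn] at hg
  obtain ⟨s, t, hst, hgst⟩ : ∃ s t, s < t ∧ g s = g t := by
    obtain ⟨s, t, hne, hgst⟩ := Fintype.exists_ne_map_eq_of_card_lt g (by simp)
    rcases hne.lt_or_gt with h | h
    exacts [⟨s, t, h, hgst⟩, ⟨t, s, h, hgst.symm⟩]
  obtain ⟨B, hB, hBw⟩ := exists_template12Q_blockSet (Fin.lt_def.1 hst)
    (Nat.lt_succ_iff.1 t.2) hx hxn
  have hcol : ∀ w ∈ B, χ n hn w = g s := by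
    intro w hw
    obtain ⟨P, hP, hPc, u, rfl | rfl, rfl⟩ := hBw w hw
    · exact congrFun (hg P hP hPc) s
    · exact (congrFun (hg P hP hPc) t).trans hgst.symm
  exact hχ n hn B hB fun w hw w' hw' => (hcol w hw).trans (hcol w' hw').symm
end

section
/- For all positive integers p, q and k there exists a positive integer n such that every k-colouring of [2]^n contains a monochromatic block set of degree 1 with the template over [2] consisting of p copies of 1 and q copies of 2. -/
/-- The template over `[2]` consisting of `p` copies of `1` followed by `q` copies of `2`. -/
def templatePQ2 (p q : ℕ) : Fin (p + q) → Fin 2 :=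
  fun j => if (j : ℕ) < p then 0 else 1

/-- Every colouring of the finite subsets of a set with at least `N` vertices admits an `m`-subset
all of whose `r`-subsets have the same colour. -/
def RamseyBound (κ : Type*) (r m N : ℕ) : Prop :=
  ∀ (α : Type) [LinearOrder α] (V : Finset α), N ≤ V.card → ∀ c : Finset α → κ,
    ∃ S ⊆ V, S.card = m ∧ ∃ y, ∀ A ⊆ S, A.card = r → c A = y

/-- In a sufficiently large vertex set there are `t` vertices such that the colour of an
`(r + 1)`-set of them depends only on its least element. -/
lemma exists_minDetermined_subset {κ : Type*} {r : ℕ}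
    (hr : ∀ m, ∃ N, RamseyBound κ r m N) (t : ℕ) :
    ∃ M : ℕ, ∀ (α : Type) [LinearOrder α] (V : Finset α), M ≤ V.card → ∀ c : Finset α → κ,
      ∃ S ⊆ V, S.card = t ∧ ∃ f : α → κ, ∀ A ⊆ S, A.card = r + 1 →
        ∀ x ∈ A, (∀ y ∈ A, x ≤ y) → c A = f x := by
  induction t with
  | zero =>
    refine ⟨0, fun α _ V _ c => ⟨∅, by simp, by simp, fun _ => c ∅, ?_⟩⟩
    intro A hA hcard
    rw [Finset.subset_empty.mp hA] at hcard
    simp at hcard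
  | succ t ih =>
    obtain ⟨M, hM⟩ := ih
    obtain ⟨N, hN⟩ := hr M
    refine ⟨N + 1, fun α _ V hV c => ?_⟩
    have hne : V.Nonempty := Finset.card_pos.mp (by omega)
    obtain ⟨x, hxV, hmin⟩ : ∃ x ∈ V, ∀ y ∈ V, x ≤ y :=
      ⟨V.min' hne, V.min'_mem hne, fun y hy => V.min'_le y hy⟩
    obtain ⟨S, hSV, hS, y, hy⟩ := hN α (V.erase x)
      (by rw [Finset.card_erase_of_mem hxV]; omega) (fun A => c (insert x A))
    obtain ⟨U, hUS, hU, f, hf⟩ := hM α S hS.ge c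
    have hxU : x ∉ U := fun h => Finset.notMem_erase x V (hSV (hUS h))
    refine ⟨insert x U, ?_, by rw [Finset.card_insert_of_notMem hxU, hU],
      Function.update f x y, ?_⟩
    · exact Finset.insert_subset hxV
        ((hUS.trans hSV).trans (Finset.erase_subset x V))
    · intro A hA hcard z hzA hz
      by_cases hxA : x ∈ A
      · have hzx : z = x := by
          refine le_antisymm (hz x hxA) (hmin z ?_)
          rcases Finset.mem_insert.mp (hA hzA) with h | h
          · exact h ▸ hxV
          · exact Finset.mem_of_mem_erase (hSV (hUS h))
        rw [hzx, Function.update_self]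
        have h := hy (A.erase x) ((Finset.subset_insert_iff.mp hA).trans hUS)
          (by rw [Finset.card_erase_of_mem hxA]; omega)
        simpa only [Finset.insert_erase hxA] using h
      · have hzx : z ≠ x := fun h => hxA (h ▸ hzA)
        rw [Function.update_of_ne hzx]
        exact hf A ((Finset.subset_insert_iff_of_notMem hxA).mp hA) hcard z hzA hz

/-- **Ramsey's theorem** for uniform hypergraphs and finitely many colours. -/
theorem exists_ramseyBound (κ : Type*) [Finite κ] (r m : ℕ) : ∃ N, RamseyBound κ r m N := by
  classical
  have := Fintype.ofFinite κ
  induction r generalizing m with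
  | zero =>
    refine ⟨m, fun α _ V hV c => ?_⟩
    obtain ⟨S, hS, hcard⟩ := Finset.exists_subset_card_eq hV
    exact ⟨S, hS, hcard, c ∅, fun A _ hA => by rw [Finset.card_eq_zero.mp hA]⟩
  | succ r ih =>
    obtain ⟨M, hM⟩ := exists_minDetermined_subset ih (Fintype.card κ * m)
    refine ⟨M, fun α _ V hV c => ?_⟩
    obtain ⟨S, hSV, hS, f, hf⟩ := hM α V hV c
    have : Nonempty κ := ⟨c ∅⟩
    obtain ⟨y, -, hy⟩ := Finset.exists_le_card_fiber_of_mul_le_card_of_maps_to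
      (s := S) (t := Finset.univ) (f := f) (n := m) (fun _ _ => Finset.mem_univ _)
      Finset.univ_nonempty (by rw [Finset.card_univ, hS])
    obtain ⟨U, hU, hcard⟩ := Finset.exists_subset_card_eq hy
    have hUS : U ⊆ S := hU.trans (Finset.filter_subset _ _)
    refine ⟨U, hUS.trans hSV, hcard, y, fun A hA hAcard => ?_⟩
    have hne : A.Nonempty := Finset.card_pos.mp (by omega)
    rw [hf A (hA.trans hUS) hAcard (A.min' hne) (A.min'_mem hne) fun z hz => A.min'_le z hz]
    exact (Finset.mem_filter.mp (hU (hA (A.min'_mem hne)))).2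

lemma card_templatePQ2_comp_eq_one (p q : ℕ) (σ : Equiv.Perm (Fin (p + q))) :
    (Finset.univ.filter fun j => templatePQ2 p q (σ j) = 1).card = q := by
  have h : (Finset.univ.filter fun j => templatePQ2 p q (σ j) = 1).map σ.toEmbedding =
      (Finset.univ : Finset (Fin q)).map (Fin.natAddEmb p) := by
    ext j
    rw [Finset.mem_map_equiv]
    simp only [Finset.mem_filter_univ, Equiv.apply_symm_apply, Finset.mem_map, Finset.mem_univ,
      true_and, Fin.natAddEmb_apply]
    constructor
    · intro hj
      have hpj : p ≤ (j : ℕ) := by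
        by_contra hlt
        simp [templatePQ2, Nat.lt_of_not_le hlt] at hj
      exact ⟨⟨j - p, by omega⟩, Fin.ext (by simp; omega)⟩
    · rintro ⟨i, rfl⟩
      simp [templatePQ2]
  simpa using congrArg Finset.card h

/-- For all positive integers `p`, `q` and `k` there exists `n ≥ 1` such that every
`k`-colouring of `[2]^n` contains a monochromatic block set of degree `1` with the template
consisting of `p` `1`'s and `q` `2`'s. -/
theorem alphabet_two_degree_one (p q k : ℕ) (hp : 0 < p) (hq : 0 < q) (hk : 0 < k) :
    ∃ n : ℕ, 0 < n ∧
      ∀ χ : (Fin n → Fin 2) → Fin k,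
        ∃ B : Set (Fin n → Fin 2),
          IsBlockSet (templatePQ2 p q) 1 B ∧ Monochromatic χ B := by
  obtain ⟨N, hN⟩ := exists_ramseyBound (Fin k) q (p + q)
  refine ⟨N + 1, N.succ_pos, fun χ => ?_⟩
  obtain ⟨S, -, hS, y, hy⟩ := hN (Fin (N + 1)) Finset.univ (by simp)
    (fun A => χ fun i => if i ∈ A then 1 else 0)
  let e := S.orderEmbOfFin hS
  refine ⟨_, ⟨fun j => {e j}, fun _ => 0, fun j j' hj => ?_, fun j => by simp, rfl⟩, ?_⟩
  · simpa using hj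
  have key : ∀ w : Fin (N + 1) → Fin 2,
      (∀ i, (∀ j, i ∉ ({e j} : Finset (Fin (N + 1)))) → w i = 0) →
      (∃ σ : Equiv.Perm (Fin (p + q)), ∀ j, ∀ i ∈ ({e j} : Finset (Fin (N + 1))),
        w i = templatePQ2 p q (σ j)) → χ w = y := by
    rintro w hw ⟨σ, hσ⟩
    have hmem : ∀ i, w i = 1 → ∃ j, e j = i := by
      intro i hi
      by_contra! h
      have := hw i fun j => by simpa using (h j).symm
      simp [this] at hi
    have hA : Finset.univ.filter (fun i => w i = 1) =
        (Finset.univ.filter fun j => templatePQ2 p q (σ j) = 1).map e.toEmbedding := by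
      ext i
      simp only [Finset.mem_filter_univ, Finset.mem_map, RelEmbedding.coe_toEmbedding]
      constructor
      · intro hi
        obtain ⟨j, rfl⟩ := hmem i hi
        exact ⟨j, by rw [← hσ j (e j) (by simp), hi], rfl⟩
      · rintro ⟨j, hj, rfl⟩
        rw [hσ j (e j) (by simp), hj]
    have h := hy (Finset.univ.filter fun i => w i = 1) (fun i hi => ?_)
      (by rw [hA, Finset.card_map, card_templatePQ2_comp_eq_one])
    · rw [← h]
      congr 1
      funext i
      by_cases hi : w i = 1
      · simp [hi]
      · simp only [Finset.mem_filter_univ, hi, if_false]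
        omega
    · obtain ⟨j, rfl⟩ := hmem i (Finset.mem_filter.mp hi).2
      exact S.orderEmbOfFin_mem hS j
  exact fun w hw w' hw' => (key w hw.1 hw.2).trans (key w' hw'.1 hw'.2).symm
end

section
/- For every positive integer k there exists a positive integer n such that for every k-colouring of ℤ^n there exist x ∈ ℤ^n and v ∈ {0,1}^n with v ≠ 0 such that x, x + v and x + 2v all receive the same colour. (Equivalently, every k-colouring of ℤ^n, for n sufficiently large, contains a monochromatic 3-term arithmetic progression whose common difference has ℓ∞ norm equal to 1 and nonnegative coordinates.) -/
/-!
For every `k` and large enough `n`, every `k`-colouring of `ℤ^n` contains a monochromatic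
3-term arithmetic progression `x, x + v, x + 2v` whose common difference `v` is a nonzero
0–1 vector. This is the Hales–Jewett theorem over the alphabet `{0, 1, 2} ⊆ ℤ`: the common
difference is the indicator of the active coordinates of a monochromatic combinatorial line.
-/

theorem monochromatic_AP3_zeroOne_difference (k : ℕ) (hk : 0 < k) :
    ∃ n : ℕ, 0 < n ∧
      ∀ χ : (Fin n → ℤ) → Fin k,
        ∃ x v : Fin n → ℤ,
          (∀ i, v i = 0 ∨ v i = 1) ∧ v ≠ 0 ∧
          χ (x + v) = χ x ∧ χ (x + v + v) = χ x := by
  obtain ⟨n, hn⟩ := Combinatorics.Subspace.exists_mono_in_high_dimension_fin (Fin 3) (Fin k) Unit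
  refine ⟨n, ?_, fun χ => ?_⟩
  · obtain ⟨l, -⟩ := hn fun _ => ⟨0, hk⟩
    obtain ⟨i, -⟩ := l.proper ()
    exact i.pos
  obtain ⟨l, c, hc⟩ := hn fun w => χ fun i => ((w i : ℕ) : ℤ)
  let p (a : Fin 3) (i : Fin n) : ℤ := ((l (fun _ => a) i : ℕ) : ℤ)
  let v (i : Fin n) : ℤ := (l.idxFun i).elim (fun _ => 0) (fun _ => 1)
  have hp (a : Fin 3) : χ (p a) = c := hc fun _ => a
  have h₁ : p 0 + v = p 1 := by
    funext i
    cases h : l.idxFun i <;> simp [p, v, h, Combinatorics.Subspace.apply_def]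
  have h₂ : p 1 + v = p 2 := by
    funext i
    cases h : l.idxFun i <;> simp [p, v, h, Combinatorics.Subspace.apply_def]
  refine ⟨p 0, v, fun i => ?_, fun hv => ?_, ?_, ?_⟩
  · cases h : l.idxFun i <;> simp [v, h]
  · obtain ⟨i, hi⟩ := l.proper ()
    simpa [v, hi] using congrFun hv i
  · rw [h₁, hp, hp]
  · rw [h₁, h₂, hp, hp]
end
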